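/- Every knot-like complex over R = F₂[U,V]/(UV=0) is locally equivalent to a standard complex C(a_1,…,a_n) for some (possibly empty) finite sequence (a_1,…,a_n) of nonzero integers with n even. -/

import Mathlib

/-!
Common setup: the ring `R = 𝔽₂[U,V]/(UV = 0)`, bigraded free finitely generated chain
complexes over `R` ("pre-complexes"), knot-like complexes, local maps and local
equivalence, standard and semistandard complexes, short maps, the `Z^!` order,
the invariants `a_i`, `φ_j`, `P`, shift maps, tensor products, duals, and direct sums.
-/

set_option synthInstance.maxHeartbeats 1000000
set_option maxHeartbeats 1000000

noncomputable section

/-- The polynomial ring `𝔽₂[U,V]`. -/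
abbrev PolyUV : Type := MvPolynomial (Fin 2) (ZMod 2)

/-- The ideal `(U·V)`. -/
def IUV : Ideal PolyUV := Ideal.span {(MvPolynomial.X 0 * MvPolynomial.X 1 : PolyUV)}

/-- The ring `R = 𝔽₂[U,V]/(UV = 0)`. -/
abbrev RUV : Type := PolyUV ⧸ IUV

instance : CommRing RUV := Ideal.Quotient.commRing IUV

/-- The image of `U` in `R`. -/
def Uv : RUV := Ideal.Quotient.mk IUV (MvPolynomial.X 0)

/-- The image of `V` in `R`. -/
def Vv : RUV := Ideal.Quotient.mk IUV (MvPolynomial.X 1)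

/-- `r ∈ R` is homogeneous of bidegree `(p, q)` for the bigrading with
`gr(U) = (-2, 0)`, `gr(V) = (0, -2)`, `gr(1) = (0, 0)` (coefficients in `𝔽₂`). -/
def IsHomog (r : RUV) (p q : ℤ) : Prop :=
  r = 0 ∨ (∃ a : ℕ, r = Uv ^ a ∧ p = -(2 * (a : ℤ)) ∧ q = 0) ∨
    (∃ b : ℕ, r = Vv ^ b ∧ p = 0 ∧ q = -(2 * (b : ℤ)))

/-- A finitely generated free bigraded module over `R` with a distinguished basis
indexed by `Fin n`, together with a bigrading `gr` on the basis and a matrix `dm`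
recording a prospective differential: `dm i j` is the coefficient of the `j`-th basis
vector in the differential of the `i`-th basis vector. -/
structure PreCx where
  n : ℕ
  gr : Fin n → ℤ × ℤ
  dm : Fin n → Fin n → RUV

/-- The underlying free `R`-module of a pre-complex. -/
abbrev Msub (C : PreCx) : Type := Fin C.n →₀ RUV

/-- The differential of a pre-complex, as an `R`-linear map. -/
def dmap (C : PreCx) : Msub C →ₗ[RUV] Msub C :=
  Finsupp.linearCombination RUV fun i => ∑ j, Finsupp.single j (C.dm i j)

/-- The submodule `U·C ⊆ C`; `C/U` is the quotient by this submodule. -/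
def uSub (C : PreCx) : Submodule RUV (Msub C) :=
  LinearMap.range (LinearMap.lsmul RUV (Msub C) Uv)

/-- The submodule `V·C ⊆ C`; `C/V` is the quotient by this submodule. -/
def vSub (C : PreCx) : Submodule RUV (Msub C) :=
  LinearMap.range (LinearMap.lsmul RUV (Msub C) Vv)

/-- Chains which die in the homology of `C/U`: the preimage in `C` of the boundaries of
the induced differential on `C/U`. -/
def bdryU (C : PreCx) : Submodule RUV (Msub C) := uSub C ⊔ LinearMap.range (dmap C)

/-- Chains which die in the homology of `C/V`. -/
def bdryV (C : PreCx) : Submodule RUV (Msub C) := vSub C ⊔ LinearMap.range (dmap C)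

/-- A chain `x ∈ C` is homogeneous of bidegree `(p, q)`. -/
def ChainHomog (C : PreCx) (x : Msub C) (p q : ℤ) : Prop :=
  ∀ j, IsHomog (x j) (p - (C.gr j).1) (q - (C.gr j).2)

/-- `x` is a `V`-tower class generator: its class in `H_*(C/U)` is a `V`-nontorsion cycle
whose image generates `H_*(C/U)/(V-torsion)` (equivalently, it is maximally `V`-graded
among `V`-nontorsion classes). -/
def IsVTowerGen (C : PreCx) (x : Msub C) : Prop :=
  dmap C x ∈ uSub C ∧ (∀ k : ℕ, Vv ^ k • x ∉ bdryU C) ∧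
    ∀ z : Msub C, dmap C z ∈ uSub C →
      ∃ (r : RUV) (k : ℕ), Vv ^ k • (z - r • x) ∈ bdryU C

/-- `x` is a `U`-tower class generator: its class in `H_*(C/V)` is a `U`-nontorsion cycle
whose image generates `H_*(C/V)/(U-torsion)`. -/
def IsUTowerGen (C : PreCx) (x : Msub C) : Prop :=
  dmap C x ∈ vSub C ∧ (∀ k : ℕ, Uv ^ k • x ∉ bdryV C) ∧
    ∀ z : Msub C, dmap C z ∈ vSub C →
      ∃ (r : RUV) (k : ℕ), Uv ^ k • (z - r • x) ∈ bdryV C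

/-- `C` is a chain complex over `R` whose differential has degree `(-1, -1)`. -/
def IsCplx (C : PreCx) : Prop :=
  (∀ x, dmap C (dmap C x) = 0) ∧
    ∀ i j, IsHomog (C.dm i j) ((C.gr i).1 - 1 - (C.gr j).1) ((C.gr i).2 - 1 - (C.gr j).2)

/-- A knot-like complex: a free, finitely generated, bigraded chain complex over `R`
whose differential has degree `(-1,-1)`, such that `H_*(C/U)/(V`-torsion`) ≅ 𝔽₂[V]` with
all `V`-nontorsion elements of `H_*(C/U)` in `U`-grading `0`, and
`H_*(C/V)/(U`-torsion`) ≅ 𝔽₂[U]` with all `U`-nontorsion elements of `H_*(C/V)` in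
`V`-grading `0`. -/
structure IsKnotLike (C : PreCx) : Prop where
  dsq : ∀ x, dmap C (dmap C x) = 0
  dhomog : ∀ i j, IsHomog (C.dm i j)
    ((C.gr i).1 - 1 - (C.gr j).1) ((C.gr i).2 - 1 - (C.gr j).2)
  vTowerExists : ∃ x, IsVTowerGen C x
  vTowerGr : ∀ x p q, ChainHomog C x p q → dmap C x ∈ uSub C →
    (∀ k : ℕ, Vv ^ k • x ∉ bdryU C) → p = 0
  uTowerExists : ∃ x, IsUTowerGen C x
  uTowerGr : ∀ x p q, ChainHomog C x p q → dmap C x ∈ vSub C →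
    (∀ k : ℕ, Uv ^ k • x ∉ bdryV C) → q = 0

/-- A module map `f : C₁ → C₂` is homogeneous of bidegree `(s, t)`. -/
def MapHomogShift (C₁ C₂ : PreCx) (f : Msub C₁ →ₗ[RUV] Msub C₂) (s t : ℤ) : Prop :=
  ∀ i j, IsHomog (f (Finsupp.single i 1) j)
    ((C₁.gr i).1 + s - (C₂.gr j).1) ((C₁.gr i).2 + t - (C₂.gr j).2)

/-- A local map `f : C₁ → C₂`: an absolutely `U`-graded, relatively `V`-graded,
`R`-equivariant chain map inducing an isomorphism on `H_*(·/U)/(V-torsion)`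
(equivalently, taking `V`-tower generators to `V`-tower generators). -/
structure IsLocalMap (C₁ C₂ : PreCx) (f : Msub C₁ →ₗ[RUV] Msub C₂) : Prop where
  chain : ∀ x, f (dmap C₁ x) = dmap C₂ (f x)
  graded : ∃ s : ℤ, MapHomogShift C₁ C₂ f 0 s
  towers : ∀ x, IsVTowerGen C₁ x → IsVTowerGen C₂ (f x)

/-- `C₁ ≤ C₂`: there exists a local map `C₁ → C₂`. -/
def LocalLE (C₁ C₂ : PreCx) : Prop := ∃ f, IsLocalMap C₁ C₂ f

/-- Local equivalence of complexes: local maps in both directions. -/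
def LocalEquiv (C₁ C₂ : PreCx) : Prop := LocalLE C₁ C₂ ∧ LocalLE C₂ C₁

/-- `C` is reduced: `∂ ≡ 0 mod (U, V)`. -/
def Reduced (C : PreCx) : Prop := ∀ i j, C.dm i j ∈ Ideal.span ({Uv, Vv} : Set RUV)

/-! ### Standard complexes -/

/-- The shift in bigrading from `x_k` to `x_{k+1}` in a standard complex, where the
parameter joining them is `b` (`k` is the 0-based index of the parameter, so the
parameter is a `U`-power arrow if `k` is even and a `V`-power arrow if `k` is odd). -/
def stepShift (k : ℕ) (b : ℤ) : ℤ × ℤ :=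
  if k % 2 = 0 then
    if b < 0 then (2 * (b.natAbs : ℤ) - 1, -1) else (1 - 2 * (b.natAbs : ℤ), 1)
  else
    if b < 0 then (-1, 2 * (b.natAbs : ℤ) - 1) else (1, 1 - 2 * (b.natAbs : ℤ))

/-- Bigrading of `x_i` relative to `x_0` in the standard complex with parameters `L`. -/
def grRel (L : List ℤ) (i : ℕ) : ℤ × ℤ :=
  ∑ k ∈ Finset.range i, stepShift k (L.getD k 0)

/-- The bigrading of the standard complex of parameters `L`, normalized so that
`gr_U(x_0) = 0` and `gr_V(x_n) = 0`. -/
def stdGr (L : List ℤ) (i : Fin (L.length + 1)) : ℤ × ℤ :=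
  ((grRel L (i : ℕ)).1, (grRel L (i : ℕ)).2 - (grRel L L.length).2)

/-- The differential matrix of the standard complex of parameters `L = (b_1, …, b_n)`:
for `i` odd (1-based), `∂_U x_{i-1} = U^{|b_i|} x_i` if `b_i < 0` and
`∂_U x_i = U^{b_i} x_{i-1}` if `b_i > 0`; for `i` even the same with `V` in place of `U`;
all other differentials vanish. -/
def stdDm (L : List ℤ) (i j : Fin (L.length + 1)) : RUV :=
  if (j : ℕ) = (i : ℕ) + 1 ∧ L.getD (i : ℕ) 0 < 0 then
    (if (i : ℕ) % 2 = 0 then Uv else Vv) ^ (L.getD (i : ℕ) 0).natAbs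
  else if (i : ℕ) = (j : ℕ) + 1 ∧ 0 < L.getD (j : ℕ) 0 then
    (if (j : ℕ) % 2 = 0 then Uv else Vv) ^ (L.getD (j : ℕ) 0).natAbs
  else 0

/-- The standard complex `C(b_1, …, b_n)` of a list of parameters `L = (b_1, …, b_n)`,
with generators `x_0, …, x_n`.  (For `L = []` this is the trivial complex `R`.) -/
def StdCx (L : List ℤ) : PreCx := ⟨L.length + 1, stdGr L, stdDm L⟩

/-- `L` is a valid parameter sequence for a standard complex: all entries are nonzero
and the length is even (possibly zero). -/
def IsStdSeq (L : List ℤ) : Prop := (∀ b ∈ L, b ≠ 0) ∧ Even L.length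

/-- The trivial standard complex `C(0) = R`. -/
def trivCx : PreCx := StdCx []

/-- The bigrading of the semistandard complex `C'(b_1, …, b_n)` (`n` odd), inherited from
the ambient standard complex `C(b_1, …, b_n, 1)`. -/
def semiGr (L : List ℤ) (i : Fin (L.length + 1)) : ℤ × ℤ :=
  ((grRel L (i : ℕ)).1, (grRel L (i : ℕ)).2 - (grRel L L.length).2 + 1)

/-- The semistandard complex `C'(b_1, …, b_n)` (`n` odd): the subcomplex of
`C(b_1, …, b_n, 1)` generated by `x_0, …, x_n`. -/
def SemiStdCx (L : List ℤ) : PreCx := ⟨L.length + 1, semiGr L, stdDm L⟩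

/-! ### Tensor products, duals, direct sums -/

/-- The tensor product (over `R`) of two pre-complexes, with basis `x_i ⊗ y_j` and
differential `∂(x ⊗ y) = ∂x ⊗ y + x ⊗ ∂y` (signs are irrelevant in characteristic 2). -/
def tensorCx (C₁ C₂ : PreCx) : PreCx where
  n := C₁.n * C₂.n
  gr := fun p => C₁.gr (finProdFinEquiv.symm p).1 + C₂.gr (finProdFinEquiv.symm p).2
  dm := fun p q =>
    (if (finProdFinEquiv.symm p).2 = (finProdFinEquiv.symm q).2 then
      C₁.dm (finProdFinEquiv.symm p).1 (finProdFinEquiv.symm q).1 else 0) +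
    (if (finProdFinEquiv.symm p).1 = (finProdFinEquiv.symm q).1 then
      C₂.dm (finProdFinEquiv.symm p).2 (finProdFinEquiv.symm q).2 else 0)

/-- The dual complex `C^∨ = Hom_R(C, R)`, described on the dual basis: the gradings are
negated and the differential matrix is transposed. -/
def dualCx (C : PreCx) : PreCx := ⟨C.n, fun i => -C.gr i, fun i j => C.dm j i⟩

/-- The direct sum of two pre-complexes. -/
def sumCx (C₁ C₂ : PreCx) : PreCx where
  n := C₁.n + C₂.n
  gr := fun p => Sum.elim C₁.gr C₂.gr (finSumFinEquiv.symm p)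
  dm := fun p q =>
    match finSumFinEquiv.symm p, finSumFinEquiv.symm q with
    | Sum.inl i, Sum.inl k => C₁.dm i k
    | Sum.inr j, Sum.inr l => C₂.dm j l
    | _, _ => 0

/-- A homotopy equivalence of bigraded chain complexes over `R`: chain maps `f, g`
preserving the bigrading, with `g ∘ f ≃ id` and `f ∘ g ≃ id` via `R`-equivariant
homotopies of bidegree `(1, 1)`. -/
def HomotopyEquivCx (C₁ C₂ : PreCx) : Prop :=
  ∃ (f : Msub C₁ →ₗ[RUV] Msub C₂) (g : Msub C₂ →ₗ[RUV] Msub C₁)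
    (H : Msub C₁ →ₗ[RUV] Msub C₁) (K : Msub C₂ →ₗ[RUV] Msub C₂),
    (∀ x, f (dmap C₁ x) = dmap C₂ (f x)) ∧
    (∀ y, g (dmap C₂ y) = dmap C₁ (g y)) ∧
    MapHomogShift C₁ C₂ f 0 0 ∧ MapHomogShift C₂ C₁ g 0 0 ∧
    MapHomogShift C₁ C₁ H 1 1 ∧ MapHomogShift C₂ C₂ K 1 1 ∧
    (∀ x, g (f x) - x = dmap C₁ (H x) + H (dmap C₁ x)) ∧
    (∀ y, f (g y) - y = dmap C₂ (K y) + K (dmap C₂ y))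

/-- An isomorphism of bigraded chain complexes over `R`. -/
def IsBigradedChainIso (C₁ C₂ : PreCx) (f : Msub C₁ →ₗ[RUV] Msub C₂) : Prop :=
  Function.Bijective f ∧ (∀ x, f (dmap C₁ x) = dmap C₂ (f x)) ∧ MapHomogShift C₁ C₂ f 0 0

/-! ### Short maps -/

/-- A short map `f : C(b_1, …, b_n) ⇝ C`: an absolutely `U`-graded, relatively
`V`-graded `R`-module map which is a chain map at `x_1, …, x_{n-1}` and commutes with
the `V`-part of the differential at `x_n` (for reduced `C`, the failure
`∂ f(x_n) - f(∂_V x_n)` is exactly `∂_U f(x_n) ∈ U·C`). -/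
def IsShortMap (L : List ℤ) (C : PreCx) (f : Msub (StdCx L) →ₗ[RUV] Msub C) : Prop :=
  (∃ s : ℤ, MapHomogShift (StdCx L) C f 0 s) ∧
  (∀ i : Fin (L.length + 1), 1 ≤ (i : ℕ) → (i : ℕ) + 1 ≤ L.length →
    f (dmap (StdCx L) (Finsupp.single i 1)) = dmap C (f (Finsupp.single i 1))) ∧
  dmap C (f (Finsupp.single (Fin.last L.length) 1)) -
    f (dmap (StdCx L) (Finsupp.single (Fin.last L.length) 1)) ∈ uSub C

/-- A short local map: a short map sending the `V`-tower generator `x_0` to a `V`-tower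
generator (hence inducing an isomorphism on `H_*(·/U)/(V-torsion)`). -/
def IsShortLocalMap (L : List ℤ) (C : PreCx) (f : Msub (StdCx L) →ₗ[RUV] Msub C) : Prop :=
  IsShortMap L C f ∧ IsVTowerGen C (f (Finsupp.single (0 : Fin (L.length + 1)) 1))

/-- A local map from the semistandard complex `C'(b_1, …, b_n)` to a knot-like complex:
a grading-preserving `R`-equivariant chain map under which the class of `x_0`
generates `H_*(C/U)/(V-torsion)`. -/
def IsSemiLocalMap (L : List ℤ) (C : PreCx) (f : Msub (SemiStdCx L) →ₗ[RUV] Msub C) : Prop :=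
  (∀ x, f (dmap (SemiStdCx L) x) = dmap C (f x)) ∧
  MapHomogShift (SemiStdCx L) C f 0 0 ∧
  IsVTowerGen C (f (Finsupp.single (0 : Fin (L.length + 1)) 1))

/-! ### The order `Z^!` and the numerical invariants -/

/-- The embedding of `Z^!` into `ℚ` realizing the order
`-1 <^! -2 <^! ⋯ <^! 0 <^! ⋯ <^! 2 <^! 1`: send `0 ↦ 0` and `a ↦ 1/a` otherwise. -/
def qval (a : ℤ) : ℚ := if a = 0 then 0 else 1 / (a : ℚ)

/-- The order `≤^!` on `Z^!`. -/
def bangLE (a b : ℤ) : Prop := qval a ≤ qval b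

/-- Pad a finite sequence with trailing zeros. -/
def seqPad (L : List ℤ) (i : ℕ) : ℤ := L.getD i 0

/-- The lexicographic order on finite integer sequences induced by `≤^!`, padding the
shorter sequence with trailing zeros. -/
def bangLexLE (L₁ L₂ : List ℤ) : Prop :=
  (∀ i, seqPad L₁ i = seqPad L₂ i) ∨
    ∃ k, (∀ i < k, seqPad L₁ i = seqPad L₂ i) ∧ qval (seqPad L₁ k) < qval (seqPad L₂ k)

/-- `m` is an upper bound for `S ⊆ Z^!` with respect to `≤^!`. -/
def IsBangUB (S : Set ℤ) (m : ℤ) : Prop := ∀ b ∈ S, qval b ≤ qval m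

/-- `m = sup^! S`, the least upper bound of `S ⊆ Z^!` with respect to `≤^!`. -/
def IsBangLUB (S : Set ℤ) (m : ℤ) : Prop :=
  IsBangUB S m ∧ ∀ m' : ℤ, IsBangUB S m' → qval m ≤ qval m'

/-- Candidate set for the next invariant: given the already-constructed prefix `P`,
those nonzero `b` such that some standard complex `C(P, b, rest) ≤ C`. -/
def candSet (C : PreCx) (P : List ℤ) : Set ℤ :=
  {b | b ≠ 0 ∧ ∃ rest : List ℤ, IsStdSeq (P ++ b :: rest) ∧ LocalLE (StdCx (P ++ b :: rest)) C}

/-- `a` is the sequence of numerical invariants `a_i(C)` (indexed from `0`):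
once a term vanishes all later terms vanish, and otherwise each term is
`sup^!` of the corresponding candidate set. -/
def InvSeq (C : PreCx) (a : ℕ → ℤ) : Prop :=
  ∀ k : ℕ,
    ((∃ i < k, a i = 0) → a k = 0) ∧
    ((∀ i < k, a i ≠ 0) → IsBangLUB (candSet C ((List.range k).map a)) (a k))

/-- The first `n` terms of `a`, with the (all-zero) tail deleted. -/
def truncSeq (a : ℕ → ℤ) (n : ℕ) : List ℤ :=
  ((List.range n).map a).takeWhile (fun b => b != 0)

/-! ### The homomorphisms `φ_j`, `P` and the shifts `sh_m` -/

/-- `φ_j` of a standard complex `C(a_1, …, a_n)`: the signed count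
`#{i odd : a_i = j} − #{i odd : a_i = −j}` (with 1-based odd `i`). -/
def phi (j : ℕ) (L : List ℤ) : ℤ :=
  ∑ i ∈ Finset.range L.length,
    if i % 2 = 0 then
      (if L.getD i 0 = (j : ℤ) then 1 else 0) - (if L.getD i 0 = -(j : ℤ) then 1 else 0)
    else 0

/-- The shift `sh_m` on parameter sequences: entries of absolute value `≥ m` are pushed
one further from zero; entries of absolute value `< m` are fixed. -/
def shSeq (m : ℕ) (L : List ℤ) : List ℤ :=
  L.map fun a => if (m : ℤ) ≤ a then a + 1 else if a ≤ -(m : ℤ) then a - 1 else a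

/-- `P(C) = -2 ∑_{j>0} j φ_j(C) + ∑_i sgn a_i`, computed from the parameter sequence of
the standard representative (the sum over `j` is finite since `φ_j` vanishes for
`j` larger than any `|a_i|`). -/
def Pval (L : List ℤ) : ℤ :=
  -2 * (∑ j ∈ Finset.range ((L.map Int.natAbs).sum + 1), (j : ℤ) * phi j L) +
    (L.map Int.sign).sum

end

/-- A tower of linear relations on an `𝔽₂`-vector space, modelling `∂ x = Tⁿ y`. -/
structure ArrowSystem (X : Type) [AddCommGroup X] [Module (ZMod 2) X] where
  rel : ℕ → Submodule (ZMod 2) (X × X)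
  rel_zero_right : ∀ n y, (y, 0) ∈ rel (n + 1) ↔ ∃ x, (y, x) ∈ rel n
  rel_zero_left : ∀ n x, (0, x) ∈ rel n ↔ ∃ y, (y, x) ∈ rel (n + 1)
  rel_trans : ∀ m n y x, (y, x) ∈ rel m → ∃ z, (z, y) ∈ rel n

namespace ArrowSystem

variable {X : Type} [AddCommGroup X] [Module (ZMod 2) X] (s : ArrowSystem X)

/-- Targets of arrows of length `n`. -/
def bdr (n : ℕ) : Submodule (ZMod 2) X := (s.rel n).map (LinearMap.fst _ _ _)

/-- Sources of arrows of length `n`. -/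
def cyc (n : ℕ) : Submodule (ZMod 2) X := (s.rel n).map (LinearMap.snd _ _ _)

/-- Targets of arrows of some length. -/
def bdrInf : Submodule (ZMod 2) X := ⨆ n, s.bdr n

/-- Sources of arrows of all lengths. -/
def cycInf : Submodule (ZMod 2) X := ⨅ n, s.cyc n

lemma mem_bdr {n : ℕ} {y : X} : y ∈ s.bdr n ↔ ∃ x, (y, x) ∈ s.rel n := by
  simp [bdr]

lemma mem_cyc {n : ℕ} {x : X} : x ∈ s.cyc n ↔ ∃ y, (y, x) ∈ s.rel n := by
  simp [cyc]

lemma bdr_mono : Monotone s.bdr := by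
  refine monotone_nat_of_le_succ fun n y hy => ?_
  exact s.mem_bdr.2 ⟨0, (s.rel_zero_right n y).2 (s.mem_bdr.1 hy)⟩

lemma cyc_anti : Antitone s.cyc := by
  refine antitone_nat_of_succ_le fun n x hx => ?_
  exact s.mem_cyc.2 ⟨0, (s.rel_zero_left n x).2 (s.mem_cyc.1 hx)⟩

lemma mem_bdrInf {y : X} : y ∈ s.bdrInf ↔ ∃ n, y ∈ s.bdr n :=
  Submodule.mem_iSup_of_directed _ s.bdr_mono.directed_le

lemma mem_cycInf {x : X} : x ∈ s.cycInf ↔ ∀ n, x ∈ s.cyc n := Submodule.mem_iInf _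

lemma bdr_le_cyc (m n : ℕ) : s.bdr m ≤ s.cyc n := by
  intro y hy
  obtain ⟨x, hx⟩ := s.mem_bdr.1 hy
  exact s.mem_cyc.2 (s.rel_trans m n y x hx)

lemma bdrInf_le_cycInf : s.bdrInf ≤ s.cycInf :=
  iSup_le fun m => le_iInf fun n => s.bdr_le_cyc m n

/-- The relation attached to a signed length: pairs (previous, next). -/
def step (b : ℤ) : Submodule (ZMod 2) (X × X) :=
  if 0 < b then s.rel b.natAbs
  else (s.rel b.natAbs).comap (LinearEquiv.prodComm (ZMod 2) X X).toLinearMap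

lemma mem_step_of_pos {b : ℤ} (hb : 0 < b) {x x' : X} :
    (x, x') ∈ s.step b ↔ (x, x') ∈ s.rel b.natAbs := by
  simp [step, hb]

lemma mem_step_of_neg {b : ℤ} (hb : b < 0) {x x' : X} :
    (x, x') ∈ s.step b ↔ (x', x) ∈ s.rel b.natAbs := by
  rw [step, if_neg hb.not_gt]
  exact Iff.rfl

lemma mem_step_neg {b : ℤ} (hb : b ≠ 0) {x x' : X} :
    (x, x') ∈ s.step (-b) ↔ (x', x) ∈ s.step b := by
  rcases lt_or_gt_of_ne hb with h | h
  · rw [mem_step_of_neg s h, mem_step_of_pos s (by omega), Int.natAbs_neg]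
  · rw [mem_step_of_pos s h, mem_step_of_neg s (by omega), Int.natAbs_neg]

/-- Vectors which are the start of a step of signed length `b` (`0` meaning: infinitely long). -/
def dom (b : ℤ) : Submodule (ZMod 2) X :=
  if 0 < b then s.bdr b.natAbs else if b = 0 then s.cycInf else s.cyc b.natAbs

/-- The largest member of the flag strictly below `dom b`. -/
def domLt (b : ℤ) : Submodule (ZMod 2) X :=
  if 0 < b then s.bdr (b.natAbs - 1) else if b = 0 then s.bdrInf else s.cyc (b.natAbs + 1)

lemma mem_dom_of_step {b : ℤ} (hb : b ≠ 0) {x x' : X} (h : (x, x') ∈ s.step b) :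
    x ∈ s.dom b := by
  rcases lt_or_gt_of_ne hb with h' | h'
  · rw [mem_step_of_neg s h'] at h
    simpa [dom, h'.le, h'.not_gt, hb] using s.mem_cyc.2 ⟨_, h⟩
  · rw [mem_step_of_pos s h'] at h
    simpa [dom, h'] using s.mem_bdr.2 ⟨_, h⟩

lemma step_zero_of_mem_domLt {b : ℤ} (hb : b ≠ 0) {x : X} (h : x ∈ s.domLt b) :
    (x, 0) ∈ s.step b := by
  rcases lt_or_gt_of_ne hb with h' | h'
  · rw [mem_step_of_neg s h', s.rel_zero_left]
    simpa [domLt, h'.le, h'.not_gt, hb, mem_cyc] using h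
  · rw [mem_step_of_pos s h']
    obtain ⟨n, hn⟩ : ∃ n, b.natAbs = n + 1 := ⟨b.natAbs - 1, by omega⟩
    rw [hn, s.rel_zero_right]
    simpa [domLt, h', hn, mem_bdr] using h

lemma mem_domLt_of_step_zero {b : ℤ} (hb : b ≠ 0) {x : X} (h : (x, 0) ∈ s.step b) :
    x ∈ s.domLt b := by
  rcases lt_or_gt_of_ne hb with h' | h'
  · rw [mem_step_of_neg s h', s.rel_zero_left] at h
    simpa [domLt, h'.le, h'.not_gt, hb, mem_cyc] using h
  · rw [mem_step_of_pos s h'] at h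
    obtain ⟨n, hn⟩ : ∃ n, b.natAbs = n + 1 := ⟨b.natAbs - 1, by omega⟩
    rw [hn, s.rel_zero_right] at h
    simpa [domLt, h', hn, mem_bdr] using h

lemma dom_le_domLt {b b' : ℤ} (h : qval b' < qval b) : s.dom b ≤ s.domLt b' := by
  unfold dom domLt
  have hbi : ∀ n, s.bdr n ≤ s.bdrInf := fun n => le_iSup s.bdr n
  have hci : ∀ n, s.cycInf ≤ s.cyc n := fun n => iInf_le s.cyc n
  rcases lt_trichotomy b 0 with hb | hb | hb <;> rcases lt_trichotomy b' 0 with hb' | hb' | hb'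
  · have : b.natAbs ≥ b'.natAbs + 1 := by
      simp only [qval, hb.ne, hb'.ne, if_false] at h
      have h1 : (b : ℚ) < 0 := by exact_mod_cast hb
      have h2 : (b' : ℚ) < 0 := by exact_mod_cast hb'
      rw [one_div_lt_one_div_of_neg h2 h1] at h
      have : b < b' := by exact_mod_cast h
      omega
    simpa [hb.not_gt, hb.ne, hb'.not_gt, hb'.ne] using s.cyc_anti this
  · exfalso
    have h1 : (b : ℚ) < 0 := by exact_mod_cast hb
    simp only [qval, hb.ne, hb', if_false, if_true] at h
    have := one_div_neg.2 h1
    linarith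
  · exfalso
    have h1 : (b : ℚ) < 0 := by exact_mod_cast hb
    have h2 : (0 : ℚ) < b' := by exact_mod_cast hb'
    simp only [qval, hb.ne, hb'.ne', if_false] at h
    have := one_div_neg.2 h1
    have := one_div_pos.2 h2
    linarith
  · simpa [hb, hb'.not_gt, hb'.ne] using hci _
  · simp [hb, hb'] at h
  · exfalso
    have h2 : (0 : ℚ) < b' := by exact_mod_cast hb'
    simp only [qval, hb, hb'.ne', if_false, if_true] at h
    have := one_div_pos.2 h2
    linarith
  · simpa [hb, hb'.not_gt, hb'.ne] using s.bdr_le_cyc _ _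
  · simpa [hb, hb'] using hbi _
  · have : b.natAbs ≤ b'.natAbs - 1 := by
      simp only [qval, hb.ne', hb'.ne', if_false] at h
      have h1 : (0 : ℚ) < b := by exact_mod_cast hb
      have h2 : (0 : ℚ) < b' := by exact_mod_cast hb'
      rw [one_div_lt_one_div h2 h1] at h
      have : b < b' := by exact_mod_cast h
      omega
    simpa [hb, hb'] using s.bdr_mono this

/-- A pair of functionals annihilating a step. -/
def CoStep (b : ℤ) (f f' : Module.Dual (ZMod 2) X) : Prop :=
  ∀ x x', (x, x') ∈ s.step b → f x = f' x'

lemma CoStep.neg {s : ArrowSystem X} {b : ℤ} (hb : b ≠ 0) {f f' : Module.Dual (ZMod 2) X}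
    (h : s.CoStep b f f') : s.CoStep (-b) f' f :=
  fun x x' hx => (h x' x ((s.mem_step_neg hb).1 hx)).symm

lemma CoStep.eq_zero {s : ArrowSystem X} {b : ℤ} (hb : b ≠ 0) {f f' : Module.Dual (ZMod 2) X}
    (h : s.CoStep b f f') {x : X} (hx : x ∈ s.domLt b) : f x = 0 := by
  simpa using h x 0 (s.step_zero_of_mem_domLt hb hx)

/-- Comparison of a path of vectors with a path of functionals at the first letter where
their words may differ. -/
lemma qval_le_of_paths (σ : ℕ → ArrowSystem X) (b : ℕ → ℤ) (m : ℕ) (c c' : ℤ) (x : ℕ → X)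
    (f : ℕ → Module.Dual (ZMod 2) X)
    (hx : ∀ t < m, (x t, x (t + 1)) ∈ (σ t).step (b t))
    (hf : ∀ t < m, (σ t).CoStep (b t) (f t) (f (t + 1)))
    (h0 : f 0 (x 0) ≠ 0) (hc : x m ∈ (σ m).dom c)
    (hc' : ∀ y ∈ (σ m).domLt c', f m y = 0) : qval c ≤ qval c' := by
  have key : ∀ t ≤ m, f t (x t) ≠ 0 := by
    intro t
    induction t with
    | zero => exact fun _ => h0
    | succ t ih =>
      intro ht
      rw [← hf t (by omega) _ _ (hx t (by omega))]
      exact ih (by omega)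
  by_contra! hlt
  exact key m le_rfl (hc' _ ((σ m).dom_le_domLt hlt hc))

/-- The image of a subspace under a step. -/
def image (b : ℤ) (S : Submodule (ZMod 2) X) : Submodule (ZMod 2) X :=
  (s.step b ⊓ S.comap (LinearMap.fst _ _ _)).map (LinearMap.snd _ _ _)

lemma mem_image {b : ℤ} {S : Submodule (ZMod 2) X} {x' : X} :
    x' ∈ s.image b S ↔ ∃ x ∈ S, (x, x') ∈ s.step b := by
  simp [image, and_comm]

lemma image_le_cyc {b : ℤ} (hb : b ≠ 0) (S : Submodule (ZMod 2) X) : s.image b S ≤ s.cyc 1 := by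
  intro x' hx'
  obtain ⟨x, -, h⟩ := s.mem_image.1 hx'
  rcases lt_or_gt_of_ne hb with h' | h'
  · rw [mem_step_of_neg s h'] at h
    exact s.bdr_le_cyc _ _ (s.mem_bdr.2 ⟨_, h⟩)
  · rw [mem_step_of_pos s h'] at h
    exact s.cyc_anti (by omega : 1 ≤ b.natAbs) (s.mem_cyc.2 ⟨_, h⟩)

lemma bdr_le_image {b : ℤ} (hb : b ≠ 0) (S : Submodule (ZMod 2) X) : s.bdr 0 ≤ s.image b S := by
  intro x hx
  refine s.mem_image.2 ⟨0, S.zero_mem, ?_⟩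
  rw [← neg_neg b, mem_step_neg s (by omega)]
  refine s.step_zero_of_mem_domLt (by omega) ?_
  rcases lt_or_gt_of_ne hb with h' | h'
  · have : 0 < -b := by omega
    simpa [domLt, h'] using s.bdr_mono (Nat.zero_le _) hx
  · simpa [domLt, h'.le, h'.not_gt, hb] using s.bdr_le_cyc 0 _ hx

/-- A one-step descent: a functional killing the image of `S` is the end of a co-step
starting at a functional killing `S`. -/
lemma exists_coStep {b : ℤ} {S : Submodule (ZMod 2) X} (f' : Module.Dual (ZMod 2) X)
    (h : ∀ x ∈ s.image b S, f' x = 0) :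
    ∃ f : Module.Dual (ZMod 2) X, (∀ x ∈ S, f x = 0) ∧ s.CoStep b f f' := by
  let φ : (s.step b × S) →ₗ[ZMod 2] X :=
    LinearMap.coprod ((LinearMap.fst _ _ _).comp (s.step b).subtype) S.subtype
  let ψ : (s.step b × S) →ₗ[ZMod 2] ZMod 2 :=
    f'.comp ((LinearMap.snd _ _ _).comp ((s.step b).subtype.comp (LinearMap.fst _ _ _)))
  have hψ : ψ ∈ LinearMap.range φ.dualMap := by
    rw [LinearMap.range_dualMap_eq_dualAnnihilator_ker, Submodule.mem_dualAnnihilator]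
    rintro ⟨⟨⟨x, x'⟩, hx⟩, ⟨y, hy⟩⟩ hk
    have hxy : x + y = 0 := by simpa [φ] using hk
    have : x ∈ S := by
      rw [eq_neg_of_add_eq_zero_left hxy]; exact S.neg_mem hy
    exact h x' (s.mem_image.2 ⟨x, this, hx⟩)
  obtain ⟨f, hf⟩ := hψ
  refine ⟨f, fun x hx => ?_, fun x x' hx => ?_⟩
  · simpa [φ, ψ] using LinearMap.congr_fun hf (0, ⟨x, hx⟩)
  · simpa [φ, ψ] using LinearMap.congr_fun hf (⟨(x, x'), hx⟩, 0)

lemma exists_functional {S : Submodule (ZMod 2) X} {x : X} (hx : x ∉ S) :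
    ∃ f : Module.Dual (ZMod 2) X, (∀ y ∈ S, f y = 0) ∧ f x ≠ 0 := by
  obtain ⟨f, hf, hS⟩ := Submodule.exists_le_ker_of_notMem hx
  exact ⟨f, fun y hy => hS hy, hf⟩

/-- Choice of the next letter. -/
lemma exists_step [Module.Finite (ZMod 2) X] {Sm Sp : Submodule (ZMod 2) X}
    (hne : ¬ Sp ≤ Sm) (hp : Sp ≤ s.cyc 1) (hm : s.bdr 0 ≤ Sm) (hmp : Sm ≤ Sp) :
    (∃ x ∈ Sp, x ∈ s.cycInf ∧ x ∉ Sm ⊔ s.bdrInf) ∨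
      ∃ b : ℤ, b ≠ 0 ∧ ¬ s.image b Sp ≤ s.image b Sm := by
  classical
  have main : ∀ b : ℤ, b ≠ 0 → (∃ x ∈ Sp, x ∈ s.dom b ∧ x ∉ Sm) →
      Sp ⊓ s.domLt b ≤ Sm → ¬ s.image b Sp ≤ s.image b Sm := by
    rintro b hb ⟨x, hx, hxb, hxm⟩ hlt hle
    obtain ⟨x', hx'⟩ : ∃ x', (x, x') ∈ s.step b := by
      rcases lt_or_gt_of_ne hb with h' | h'
      · simp only [mem_step_of_neg s h']
        simpa [dom, h'.le, h'.not_gt, hb, mem_cyc] using hxb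
      · simp only [mem_step_of_pos s h']
        simpa [dom, h', mem_bdr] using hxb
    obtain ⟨z, hz, hzx⟩ := s.mem_image.1 (hle (s.mem_image.2 ⟨x, hx, hx'⟩))
    have h0 : (x - z, 0) ∈ s.step b := by simpa using (s.step b).sub_mem hx' hzx
    have := hlt ⟨Sp.sub_mem hx (hmp hz), s.mem_domLt_of_step_zero hb h0⟩
    exact hxm (by simpa using Sm.add_mem this hz)
  by_cases hB : Sp ⊓ s.bdrInf ≤ Sm
  · by_cases hA : Sp ⊓ s.cycInf ≤ Sm
    · right
      obtain ⟨N, hN⟩ : ∃ N, Sp ⊓ s.cyc N ≤ Sm := by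
        obtain ⟨N, hN⟩ := IsArtinian.monotone_stabilizes
          ⟨fun n => OrderDual.toDual (s.cyc n), s.cyc_anti⟩
        refine ⟨N, fun x hx => hA ⟨hx.1, s.mem_cycInf.2 fun n => ?_⟩⟩
        rcases le_total n N with h | h
        · exact s.cyc_anti h hx.2
        · have := hN n h
          have h2 : s.cyc N = s.cyc n := this
          exact h2 ▸ hx.2
      have hmin := Nat.find_spec (⟨N, hN⟩ : ∃ N, Sp ⊓ s.cyc N ≤ Sm)
      have hlt := fun k hk => Nat.find_min (⟨N, hN⟩ : ∃ N, Sp ⊓ s.cyc N ≤ Sm) (m := k) hk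
      set M := Nat.find (⟨N, hN⟩ : ∃ N, Sp ⊓ s.cyc N ≤ Sm)
      have hM1 : ∀ k ≤ 1, ¬ Sp ⊓ s.cyc k ≤ Sm := fun k hk h =>
        hne fun x hx => h ⟨hx, s.cyc_anti hk (hp hx)⟩
      have hM : 2 ≤ M := by
        by_contra hM
        exact hM1 M (by omega) hmin
      have hb : (-((M - 1 : ℕ) : ℤ)) < 0 := by omega
      have habs : (-((M - 1 : ℕ) : ℤ)).natAbs = M - 1 := by omega
      refine ⟨_, hb.ne, main _ hb.ne ?_ ?_⟩
      · obtain ⟨x, hx, hxm⟩ := Set.not_subset.1 (hlt (M - 1) (by omega))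
        refine ⟨x, hx.1, ?_, hxm⟩
        rw [dom, if_neg hb.not_gt, if_neg hb.ne, habs]
        exact hx.2
      · rw [domLt, if_neg hb.not_gt, if_neg hb.ne, habs, Nat.sub_add_cancel (by omega)]
        exact hmin
    · left
      obtain ⟨x, hx, hxm⟩ := Set.not_subset.1 hA
      refine ⟨x, hx.1, hx.2, fun h => ?_⟩
      obtain ⟨y, hy, z, hz, rfl⟩ := Submodule.mem_sup.1 h
      have : z ∈ Sp := by simpa using Sp.sub_mem hx.1 (hmp hy)
      exact hxm (Sm.add_mem hy (hB ⟨this, hz⟩))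
  · right
    obtain ⟨x, hx, hxm⟩ := Set.not_subset.1 hB
    obtain ⟨n, hn⟩ := s.mem_bdrInf.1 hx.2
    have hex : ∃ n, ¬ Sp ⊓ s.bdr n ≤ Sm := ⟨n, fun h => hxm (h ⟨hx.1, hn⟩)⟩
    have hmin := Nat.find_spec hex
    have hlt := fun k hk => Nat.find_min hex (m := k) hk
    set M := Nat.find hex
    have hM : 1 ≤ M := by
      by_contra hM
      have h0 : M = 0 := by omega
      rw [h0] at hmin
      exact hmin fun x hx => hm hx.2
    have hb : (0 : ℤ) < M := by omega
    refine ⟨M, hb.ne', main _ hb.ne' ?_ ?_⟩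
    · obtain ⟨x, hx, hxm⟩ := Set.not_subset.1 hmin
      refine ⟨x, hx.1, ?_, hxm⟩
      rw [dom, if_pos hb, Int.natAbs_natCast]
      exact hx.2
    · rw [domLt, if_pos hb, Int.natAbs_natCast]
      exact not_not.1 (hlt (M - 1) (by omega))

lemma image_mono {b : ℤ} {S S' : Submodule (ZMod 2) X} (h : S ≤ S') :
    s.image b S ≤ s.image b S' := by
  intro x hx
  obtain ⟨y, hy, hyx⟩ := s.mem_image.1 hx
  exact s.mem_image.2 ⟨y, h hy, hyx⟩

/-- A path of vectors paired with a path of functionals, along the same word. -/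
structure IsPath (σ : ℕ → ArrowSystem X) (n : ℕ) (b : ℕ → ℤ) (x : ℕ → X)
    (f : ℕ → Module.Dual (ZMod 2) X) : Prop where
  ne_zero : ∀ i < n, b i ≠ 0
  step : ∀ i < n, (x i, x (i + 1)) ∈ (σ i).step (b i)
  coStep : ∀ i < n, (σ i).CoStep (b i) (f i) (f (i + 1))
  pairing : ∀ i ≤ n, f i (x i) ≠ 0

/-- Greedy construction of paths: either the path reaches a tower or it can be made
arbitrarily long. -/
lemma exists_path [Module.Finite (ZMod 2) X] (Z B : Submodule (ZMod 2) X) (k : ℕ) :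
    ∀ (σ : ℕ → ArrowSystem X) (Sm Sp : Submodule (ZMod 2) X),
      (∀ i, (σ i).cyc 1 = Z) → (∀ i, (σ i).bdr 0 = B) →
      ¬ Sp ≤ Sm → Sp ≤ Z → B ≤ Sm → Sm ≤ Sp →
      ∃ (n : ℕ) (b : ℕ → ℤ) (x : ℕ → X) (f : ℕ → Module.Dual (ZMod 2) X),
        IsPath σ n b x f ∧ x 0 ∈ Sp ∧ (∀ y ∈ Sm, f 0 y = 0) ∧
        (n = k ∨ (x n ∈ (σ n).cycInf ∧ ∀ y ∈ (σ n).bdrInf, f n y = 0)) := by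
  induction k with
  | zero =>
    intro σ Sm Sp _ _ hne _ _ _
    obtain ⟨x, hx, hxm⟩ := Set.not_subset.1 hne
    obtain ⟨f, hf, hfx⟩ := exists_functional hxm
    exact ⟨0, 0, fun _ => x, fun _ => f, ⟨by simp, by simp, by simp, fun _ _ => hfx⟩,
      hx, hf, Or.inl rfl⟩
  | succ k ih =>
    intro σ Sm Sp hZ hB hne hpZ hBm hmp
    rcases (σ 0).exists_step hne (by rwa [hZ]) (by rwa [hB]) hmp with
      ⟨x, hx, hxc, hxm⟩ | ⟨b0, hb0, him⟩
    · obtain ⟨f, hf, hfx⟩ := exists_functional hxm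
      exact ⟨0, 0, fun _ => x, fun _ => f, ⟨by simp, by simp, by simp, fun _ _ => hfx⟩,
        hx, fun y hy => hf y (Submodule.mem_sup_left hy),
        Or.inr ⟨hxc, fun y hy => hf y (Submodule.mem_sup_right hy)⟩⟩
    · obtain ⟨n, b, x, f, hp, hx0, hf0, hend⟩ := ih (fun i => σ (i + 1)) _ _
        (fun i => hZ _) (fun i => hB _) him
        (by rw [← hZ 0]; exact (σ 0).image_le_cyc hb0 _)
        (by rw [← hB 0]; exact (σ 0).bdr_le_image hb0 _) ((σ 0).image_mono hmp)
      obtain ⟨y, hy, hyx⟩ := (σ 0).mem_image.1 hx0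
      obtain ⟨g, hg, hgf⟩ := (σ 0).exists_coStep (f 0) hf0
      refine ⟨n + 1, fun i => Nat.casesOn i b0 b, fun i => Nat.casesOn i y x,
        fun i => Nat.casesOn i g f, ⟨?_, ?_, ?_, ?_⟩, hy, hg, ?_⟩
      · rintro (_ | i) hi
        · exact hb0
        · exact hp.ne_zero i (by omega)
      · rintro (_ | i) hi
        · exact hyx
        · exact hp.step i (by omega)
      · rintro (_ | i) hi
        · exact hgf
        · exact hp.coStep i (by omega)
      · rintro (_ | i) hi
        · have := hp.pairing 0 (Nat.zero_le _)
          rwa [← hgf _ _ hyx] at this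
        · exact hp.pairing i (by omega)
      · rcases hend with rfl | h
        · exact Or.inl rfl
        · exact Or.inr h

end ArrowSystem

lemma linearIndependent_of_key {ι X κ : Type} [AddCommGroup X] [Module (ZMod 2) X] [Fintype ι]
    [LinearOrder κ] (x : ι → X) (f : ι → Module.Dual (ZMod 2) X) (key : ι → κ)
    (hd : ∀ i, f i (x i) ≠ 0) (hk : ∀ i j, i ≠ j → f i (x j) ≠ 0 → key j < key i) :
    LinearIndependent (ZMod 2) x := by
  classical
  rw [Fintype.linearIndependent_iff]
  intro g hg
  by_contra! hne
  obtain ⟨i0, hi0⟩ := hne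
  obtain ⟨i, hi, hmin⟩ := Finset.exists_min_image (Finset.univ.filter fun i => g i ≠ 0) key
    ⟨i0, by simpa using hi0⟩
  have h := congrArg (f i) hg
  rw [map_sum, map_zero, Finset.sum_eq_single i] at h
  · rw [map_smul, smul_eq_mul] at h
    exact (mul_ne_zero (by simpa using hi) (hd i)) h
  · intro j _ hj
    rw [map_smul, smul_eq_mul]
    by_contra hne
    have h1 := left_ne_zero_of_mul hne
    have h2 := right_ne_zero_of_mul hne
    exact absurd (hk i j hj.symm h2) (not_lt.2 (hmin j (by simpa using h1)))
  · simp

lemma qval_injective : Function.Injective qval := by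
  intro a b h
  unfold qval at h
  split_ifs at h with h1 h2 h2
  · rw [h1, h2]
  · exact absurd h.symm (by simpa using h2)
  · exact absurd h (by simpa using h1)
  · simpa using h

namespace ArrowSystem

variable {X : Type} [AddCommGroup X] [Module (ZMod 2) X] {σ : ℕ → ArrowSystem X}
  {n : ℕ} {b : ℕ → ℤ} {x : ℕ → X} {f : ℕ → Module.Dual (ZMod 2) X}

/-- The word read backwards from position `j`, ending with the letter `0` of the tower. -/
def backWord (b : ℕ → ℤ) (j t : ℕ) : ℤ := if t < j then -b (j - 1 - t) else 0

lemma periodic_even (hσ : ∀ t, σ (t + 2) = σ t) (a t : ℕ) : σ (2 * a + t) = σ t := by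
  induction a with
  | zero => simp
  | succ a ih => rw [← ih, ← hσ (2 * a + t)]; congr 1; ring

lemma sigma_congr (hσ : ∀ t, σ (t + 2) = σ t) {s t : ℕ} (h : s % 2 = t % 2) : σ s = σ t := by
  rw [← Nat.div_add_mod s 2, ← Nat.div_add_mod t 2, periodic_even hσ, periodic_even hσ, h]

lemma IsPath.step_back (hp : IsPath σ n b x f) (hσ : ∀ t, σ (t + 2) = σ t) {j t r : ℕ}
    (hj : j ≤ n) (ht : t < j) (hr : (r + j + t) % 2 = 1) :
    (x (j - t), x (j - (t + 1))) ∈ (σ r).step (backWord b j t) := by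
  rw [backWord, if_pos ht, mem_step_neg _ (hp.ne_zero _ (by omega)),
    sigma_congr hσ (show r % 2 = (j - 1 - t) % 2 by omega)]
  have := hp.step (j - 1 - t) (by omega)
  rw [show j - 1 - t + 1 = j - t by omega] at this
  rwa [show j - (t + 1) = j - 1 - t by omega]

lemma IsPath.coStep_back (hp : IsPath σ n b x f) (hσ : ∀ t, σ (t + 2) = σ t) {j t r : ℕ}
    (hj : j ≤ n) (ht : t < j) (hr : (r + j + t) % 2 = 1) :
    (σ r).CoStep (backWord b j t) (f (j - t)) (f (j - (t + 1))) := by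
  rw [backWord, if_pos ht, sigma_congr hσ (show r % 2 = (j - 1 - t) % 2 by omega)]
  have := (hp.coStep (j - 1 - t) (by omega)).neg (hp.ne_zero _ (by omega))
  convert this using 2 <;> omega

lemma IsPath.mem_dom_back (hp : IsPath σ n b x f) (hσ : ∀ t, σ (t + 2) = σ t)
    (h0 : x 0 ∈ (σ 1).cycInf) {j t r : ℕ}
    (hj : j ≤ n) (ht : t ≤ j) (hr : (r + j + t) % 2 = 1) :
    x (j - t) ∈ (σ r).dom (backWord b j t) := by
  rcases ht.lt_or_eq with ht | rfl
  · refine mem_dom_of_step _ ?_ (hp.step_back hσ hj ht hr)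
    rw [backWord, if_pos ht]
    exact neg_ne_zero.2 (hp.ne_zero _ (by omega))
  · rw [sigma_congr hσ (show r % 2 = 1 % 2 by omega)]
    simpa [backWord, dom] using h0

lemma IsPath.eq_zero_back (hp : IsPath σ n b x f) (hσ : ∀ t, σ (t + 2) = σ t)
    (h0 : ∀ y ∈ (σ 1).bdrInf, f 0 y = 0) {j t r : ℕ}
    (hj : j ≤ n) (ht : t ≤ j) (hr : (r + j + t) % 2 = 1) :
    ∀ y ∈ (σ r).domLt (backWord b j t), f (j - t) y = 0 := by
  rcases ht.lt_or_eq with ht | rfl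
  · intro y hy
    refine (hp.coStep_back hσ hj ht hr).eq_zero ?_ hy
    rw [backWord, if_pos ht]
    exact neg_ne_zero.2 (hp.ne_zero _ (by omega))
  · rw [sigma_congr hσ (show r % 2 = 1 % 2 by omega)]
    simpa [backWord, domLt] using h0

/-- The vectors of even index on a path are linearly independent, so paths are short. -/
lemma IsPath.length_lt [Module.Finite (ZMod 2) X] (hp : IsPath σ n b x f)
    (hσ : ∀ t, σ (t + 2) = σ t) (hx : x 0 ∈ (σ 1).cycInf)
    (hf : ∀ y ∈ (σ 1).bdrInf, f 0 y = 0) :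
    n < 2 * Module.finrank (ZMod 2) X := by
  by_contra! hn
  set d := Module.finrank (ZMod 2) X
  have hli : LinearIndependent (ZMod 2) fun i : Fin (d + 1) => x (2 * i) := by
    refine linearIndependent_of_key _ (fun i : Fin (d + 1) => f (2 * i))
      (fun i => toLex fun t => qval (backWord b (2 * i) t))
      (fun i => hp.pairing _ (by omega)) ?_
    intro i j hij hne
    have hi : (i : ℕ) ≤ d := by omega
    have hj : (j : ℕ) ≤ d := by omega
    have hij' : (i : ℕ) ≠ j := fun h => hij (Fin.ext h)
    have hex : ∃ t, backWord b (2 * i) t ≠ backWord b (2 * j) t := by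
      refine ⟨min (2 * i) (2 * j), ?_⟩
      rcases lt_or_gt_of_ne hij' with h | h
      · rw [min_eq_left (by omega), backWord, backWord, if_neg (by omega), if_pos (by omega)]
        exact (neg_ne_zero.2 (hp.ne_zero _ (by omega))).symm
      · rw [min_eq_right (by omega), backWord, backWord, if_pos (by omega), if_neg (by omega)]
        exact neg_ne_zero.2 (hp.ne_zero _ (by omega))
    have hspec := Nat.find_spec hex
    have hlt := fun k hk => not_not.1 (Nat.find_min hex (m := k) hk)
    set m := Nat.find hex
    have hm : m ≤ 2 * i ∧ m ≤ 2 * j := by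
      have : m ≤ min (2 * (i : ℕ)) (2 * j) := by
        refine Nat.find_min' hex ?_
        rcases lt_or_gt_of_ne hij' with h | h
        · rw [min_eq_left (by omega), backWord, backWord, if_neg (by omega), if_pos (by omega)]
          exact (neg_ne_zero.2 (hp.ne_zero _ (by omega))).symm
        · rw [min_eq_right (by omega), backWord, backWord, if_pos (by omega), if_neg (by omega)]
          exact neg_ne_zero.2 (hp.ne_zero _ (by omega))
      omega
    refine ⟨m, fun t ht => congrArg qval (hlt t ht).symm, ?_⟩
    refine lt_of_le_of_ne ?_ fun h => hspec (qval_injective h).symm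
    refine qval_le_of_paths (fun t => σ (t + 1)) (backWord b (2 * i)) m _ _
      (fun t => x (2 * j - t)) (fun t => f (2 * i - t)) ?_ ?_ (by simpa using hne) ?_ ?_
    · intro t ht
      rw [hlt t ht]
      exact hp.step_back hσ (by omega) (by omega) (by omega)
    · intro t ht
      exact hp.coStep_back hσ (by omega) (by omega) (by omega)
    · exact hp.mem_dom_back hσ hx (by omega) (by omega) (by omega)
    · exact hp.eq_zero_back hσ hf (by omega) (by omega) (by omega)
  have := hli.fintype_card_le_finrank
  simp [d] at this

/-- A path joining the one-dimensional tower to itself has even length. -/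
lemma IsPath.even_length (hp : IsPath σ n b x f)
    (hσ : ∀ t, σ (t + 2) = σ t) (hx : x 0 ∈ (σ 1).cycInf)
    (hf : ∀ y ∈ (σ 1).bdrInf, f 0 y = 0) (hxn : x n ∈ (σ n).cycInf)
    (hfn : ∀ y ∈ (σ n).bdrInf, f n y = 0) (τ : X)
    (hτ : ∀ z ∈ (σ 1).cycInf, ∃ c : ZMod 2, z - c • τ ∈ (σ 1).bdrInf) : Even n := by
  by_contra hodd
  rw [Nat.not_even_iff] at hodd
  rw [sigma_congr hσ (show n % 2 = 1 % 2 by omega)] at hxn hfn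
  have hval : ∀ g : Module.Dual (ZMod 2) X, (∀ y ∈ (σ 1).bdrInf, g y = 0) →
      ∀ z ∈ (σ 1).cycInf, ∃ c : ZMod 2, ∀ g : Module.Dual (ZMod 2) X,
        (∀ y ∈ (σ 1).bdrInf, g y = 0) → g z = c * g τ := by
    intro g hg z hz
    obtain ⟨c, hc⟩ := hτ z hz
    refine ⟨c, fun g hg => ?_⟩
    have := hg _ hc
    rwa [map_sub, map_smul, smul_eq_mul, sub_eq_zero] at this
  obtain ⟨c0, hc0⟩ := hval _ hf _ hx
  obtain ⟨c1, hc1⟩ := hval _ hf _ hxn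
  have p0 := hp.pairing 0 (Nat.zero_le _)
  have pn := hp.pairing n le_rfl
  rw [hc0 _ hf] at p0
  rw [hc1 _ hfn] at pn
  have q0 : f 0 (x n) ≠ 0 := by
    rw [hc1 _ hf]
    exact mul_ne_zero (left_ne_zero_of_mul pn) (right_ne_zero_of_mul p0)
  have qn : f n (x 0) ≠ 0 := by
    rw [hc0 _ hfn]
    exact mul_ne_zero (left_ne_zero_of_mul p0) (right_ne_zero_of_mul pn)
  have hmid : backWord b n ((n - 1) / 2) ≠ b ((n - 1) / 2) := by
    have h0 := hp.ne_zero ((n - 1) / 2) (by omega)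
    rw [backWord, if_pos (by omega), show n - 1 - (n - 1) / 2 = (n - 1) / 2 by omega]
    omega
  have hex : ∃ t, backWord b n t ≠ b t := ⟨_, hmid⟩
  have hspec := Nat.find_spec hex
  have hlt := fun k hk => not_not.1 (Nat.find_min hex (m := k) hk)
  have hm : Nat.find hex ≤ (n - 1) / 2 := Nat.find_min' hex hmid
  set m := Nat.find hex
  refine hspec (qval_injective (le_antisymm ?_ ?_))
  · refine qval_le_of_paths σ b m _ _ (fun t => x (n - t)) f ?_ (fun t ht => hp.coStep t (by omega))
      (by simpa using q0) (hp.mem_dom_back hσ hx le_rfl (by omega) (by omega))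
      (fun y hy => (hp.coStep m (by omega)).eq_zero (hp.ne_zero m (by omega)) hy)
    intro t ht
    rw [← hlt t ht]
    exact hp.step_back hσ le_rfl (by omega) (by omega)
  · refine qval_le_of_paths σ b m _ _ x (fun t => f (n - t)) (fun t ht => hp.step t (by omega)) ?_
      (by simpa using qn) (mem_dom_of_step _ (hp.ne_zero m (by omega)) (hp.step m (by omega)))
      (hp.eq_zero_back hσ hf le_rfl (by omega) (by omega))
    intro t ht
    rw [← hlt t ht]
    exact hp.coStep_back hσ le_rfl (by omega) (by omega)

/-- The path from the `V`-tower to the `U`-tower. -/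
theorem exists_tower_path [Module.Finite (ZMod 2) X] (hσ : ∀ t, σ (t + 2) = σ t)
    (hc : (σ 0).cyc 1 = (σ 1).cyc 1) (hb : (σ 0).bdr 0 = (σ 1).bdr 0) (τ : X)
    (hτc : τ ∈ (σ 1).cycInf) (hτb : τ ∉ (σ 1).bdrInf)
    (hτ : ∀ z ∈ (σ 1).cycInf, ∃ c : ZMod 2, z - c • τ ∈ (σ 1).bdrInf) :
    ∃ (n : ℕ) (b : ℕ → ℤ) (x : ℕ → X) (f : ℕ → Module.Dual (ZMod 2) X),
      Even n ∧ IsPath σ n b x f ∧ x 0 ∈ (σ 1).cycInf ∧ (∀ y ∈ (σ 1).bdrInf, f 0 y = 0) ∧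
      x n ∈ (σ 0).cycInf ∧ ∀ y ∈ (σ 0).bdrInf, f n y = 0 := by
  have hall : ∀ i, σ i = σ 0 ∨ σ i = σ 1 := fun i => by
    rcases Nat.mod_two_eq_zero_or_one i with h | h
    · exact Or.inl (sigma_congr hσ h)
    · exact Or.inr (sigma_congr hσ h)
  obtain ⟨n, b, x, f, hp, hx, hf, hend⟩ := exists_path ((σ 1).cyc 1) ((σ 1).bdr 0)
    (2 * Module.finrank (ZMod 2) X) σ (σ 1).bdrInf (σ 1).cycInf
    (fun i => by rcases hall i with h | h <;> rw [h]; exact hc)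
    (fun i => by rcases hall i with h | h <;> rw [h]; exact hb)
    (fun h => hτb (h hτc)) (iInf_le _ 1) (le_iSup _ 0) (bdrInf_le_cycInf _)
  have hlen := hp.length_lt hσ hx hf
  obtain ⟨hxn, hfn⟩ := hend.resolve_left hlen.ne
  have hev := hp.even_length hσ hx hf hxn hfn τ hτ
  have h0 : σ n = σ 0 := sigma_congr hσ (by simpa using Nat.even_iff.1 hev)
  rw [h0] at hxn hfn
  exact ⟨n, b, x, f, hev, hp, hx, hf, hxn, hfn⟩

end ArrowSystem

/-- The variable `U` for even `k` and `V` for odd `k`. -/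
noncomputable def tv (k : ℕ) : RUV := if k % 2 = 0 then Uv else Vv

lemma tv_zero : tv 0 = Uv := rfl

lemma tv_one : tv 1 = Vv := rfl

lemma tv_add_two (k : ℕ) : tv (k + 2) = tv k := by simp [tv]

lemma Uv_mul_Vv : Uv * Vv = 0 := by
  rw [Uv, Vv, ← map_mul]
  exact Ideal.Quotient.eq_zero_iff_mem.2 (Ideal.mem_span_singleton_self _)

lemma tv_cases (k : ℕ) : (tv k = Uv ∧ tv (k + 1) = Vv) ∨ (tv k = Vv ∧ tv (k + 1) = Uv) := by
  rcases Nat.mod_two_eq_zero_or_one k with h | h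
  · left; simp [tv, h, show (k + 1) % 2 = 1 by omega]
  · right; simp [tv, h, show (k + 1) % 2 = 0 by omega]

lemma tv_mul_tv (k : ℕ) : tv k * tv (k + 1) = 0 := by
  rcases tv_cases k with ⟨h, h'⟩ | ⟨h, h'⟩ <;> rw [h, h']
  · exact Uv_mul_Vv
  · rw [mul_comm, Uv_mul_Vv]

lemma zmod2_cases (a : ZMod 2) : a = 0 ∨ a = 1 := by
  fin_cases a
  · exact Or.inl rfl
  · exact Or.inr rfl

lemma ruv_induction {P : RUV → Prop} (h0 : P 0) (h1 : P 1) (hadd : ∀ r s, P r → P s → P (r + s))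
    (hU : ∀ r, P r → P (Uv * r)) (hV : ∀ r, P r → P (Vv * r)) (r : RUV) : P r := by
  obtain ⟨p, rfl⟩ := Ideal.Quotient.mk_surjective r
  induction p using MvPolynomial.induction_on with
  | C a =>
    rcases zmod2_cases a with rfl | rfl
    · simpa using h0
    · simpa using h1
  | add p q hp hq => simpa using hadd _ _ hp hq
  | mul_X p i hp =>
    rw [map_mul, mul_comm]
    fin_cases i
    · exact hU _ hp
    · exact hV _ hp

/-- Ring homomorphisms out of `R`. -/
noncomputable def ruvLift {S : Type} [CommRing S] (j : ZMod 2 →+* S) (u v : S) (h : u * v = 0) :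
    RUV →+* S :=
  Ideal.Quotient.lift IUV (MvPolynomial.eval₂Hom j ![u, v]) (by
    have : IUV ≤ RingHom.ker (MvPolynomial.eval₂Hom j ![u, v]) := by
      rw [IUV, Ideal.span_singleton_le_iff_mem, RingHom.mem_ker]
      simpa using h
    exact fun a ha => this ha)

section ruvLift
variable {S : Type} [CommRing S] (j : ZMod 2 →+* S) (u v : S) (h : u * v = 0)

@[simp] lemma ruvLift_Uv : ruvLift j u v h Uv = u :=
  (Ideal.Quotient.lift_mk IUV _ _).trans (by simp)

@[simp] lemma ruvLift_Vv : ruvLift j u v h Vv = v :=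
  (Ideal.Quotient.lift_mk IUV _ _).trans (by simp)

end ruvLift

/-- The quotient map `R → 𝔽₂[T]` killing the other variable. -/
noncomputable def toPoly (k : ℕ) : RUV →+* Polynomial (ZMod 2) :=
  if k % 2 = 0 then ruvLift Polynomial.C Polynomial.X 0 (by simp)
  else ruvLift Polynomial.C 0 Polynomial.X (by simp)

lemma toPoly_tv (k : ℕ) : toPoly k (tv k) = Polynomial.X := by
  rcases Nat.mod_two_eq_zero_or_one k with h | h <;> simp [toPoly, tv, h]

lemma toPoly_tv_succ (k : ℕ) : toPoly k (tv (k + 1)) = 0 := by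
  rcases Nat.mod_two_eq_zero_or_one k with h | h
  · simp [toPoly, tv, h, show (k + 1) % 2 = 1 by omega]
  · simp [toPoly, tv, h, show (k + 1) % 2 = 0 by omega]

/-- Induction on `R` phrased with `tv`. -/
lemma ruv_induction_tv {P : RUV → Prop} (k : ℕ) (h0 : P 0) (h1 : P 1)
    (hadd : ∀ r s, P r → P s → P (r + s))
    (hT : ∀ r, P r → P (tv k * r)) (hT' : ∀ r, P r → P (tv (k + 1) * r)) (r : RUV) : P r := by
  rcases tv_cases k with ⟨h, h'⟩ | ⟨h, h'⟩ <;> rw [h] at hT <;> rw [h'] at hT'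
  · exact ruv_induction h0 h1 hadd hT hT' r
  · exact ruv_induction h0 h1 hadd hT' hT r

lemma tv_dvd_sub_eval (k : ℕ) (r : RUV) :
    tv (k + 1) ∣ r - Polynomial.eval₂ (algebraMap (ZMod 2) RUV) (tv k) (toPoly k r) := by
  induction r using ruv_induction_tv k with
  | h0 => simp
  | h1 => simp
  | hadd r s hr hs =>
    rw [map_add, Polynomial.eval₂_add, add_sub_add_comm]
    exact dvd_add hr hs
  | hT r hr =>
    rw [map_mul, Polynomial.eval₂_mul, toPoly_tv, Polynomial.eval₂_X, ← mul_sub]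
    exact hr.mul_left _
  | hT' r hr =>
    rw [map_mul, toPoly_tv_succ]
    simp

lemma toPoly_eq_zero {k : ℕ} {r : RUV} : toPoly k r = 0 ↔ tv (k + 1) ∣ r := by
  refine ⟨fun h => ?_, ?_⟩
  · simpa [h] using tv_dvd_sub_eval k r
  · rintro ⟨s, rfl⟩
    rw [map_mul, toPoly_tv_succ, zero_mul]

lemma dvd_of_dvd_tv_mul {k : ℕ} {r : RUV} (h : tv (k + 1) ∣ tv k * r) : tv (k + 1) ∣ r := by
  rw [← toPoly_eq_zero, map_mul, toPoly_tv] at h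
  rw [← toPoly_eq_zero]
  exact (mul_eq_zero.1 h).resolve_left Polynomial.X_ne_zero

lemma eq_zero_of_tv_dvd {k : ℕ} {r : RUV} (h : tv k ∣ r) (h' : tv (k + 1) ∣ r) : r = 0 := by
  obtain ⟨s, rfl⟩ := h
  obtain ⟨t, rfl⟩ := dvd_of_dvd_tv_mul h'
  rw [← mul_assoc, tv_mul_tv, zero_mul]

/-- The constant term. -/
noncomputable def cst : RUV →+* ZMod 2 := ruvLift (RingHom.id _) 0 0 (by simp)

@[simp] lemma cst_tv (k : ℕ) : cst (tv k) = 0 := by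
  rcases tv_cases k with ⟨h, -⟩ | ⟨h, -⟩ <;> simp [h, cst]

lemma exists_of_cst_eq_zero (k : ℕ) {r : RUV} (h : cst r = 0) :
    ∃ a b, r = tv k * a + tv (k + 1) * b := by
  have main : ∀ r : RUV, ∃ a b, r = algebraMap (ZMod 2) RUV (cst r) + tv k * a + tv (k + 1) * b := by
    intro r
    induction r using ruv_induction_tv k with
    | h0 => exact ⟨0, 0, by simp⟩
    | h1 => exact ⟨0, 0, by simp⟩
    | hadd r s hr hs =>
      obtain ⟨a, b, h⟩ := hr
      obtain ⟨a', b', h'⟩ := hs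
      refine ⟨a + a', b + b', ?_⟩
      rw [map_add, map_add]
      linear_combination h + h'
    | hT r _ => exact ⟨r, 0, by simp⟩
    | hT' r _ => exact ⟨0, r, by simp⟩
  obtain ⟨a, b, h'⟩ := main r
  exact ⟨a, b, by simpa [h] using h'⟩

/-! ### The chain level -/

/-- The submodule `T · C`. -/
noncomputable def tSub (k : ℕ) (C : PreCx) : Submodule RUV (Msub C) :=
  LinearMap.range (LinearMap.lsmul RUV (Msub C) (tv k))

section complexes
variable {C : PreCx}

lemma mem_tSub {k : ℕ} {x : Msub C} : x ∈ tSub k C ↔ ∃ z, x = tv k • z := by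
  simp [tSub, eq_comm]

lemma tSub_add_two (k : ℕ) : tSub (k + 2) C = tSub k C := by
  rw [tSub, tv_add_two]; rfl

lemma smul_mem_tSub (k : ℕ) (z : Msub C) : tv k • z ∈ tSub k C := mem_tSub.2 ⟨z, rfl⟩

lemma mem_tSub_iff {k : ℕ} {x : Msub C} : x ∈ tSub k C ↔ ∀ i, tv k ∣ x i := by
  rw [mem_tSub]
  refine ⟨?_, fun h => ?_⟩
  · rintro ⟨z, rfl⟩ i
    exact ⟨z i, rfl⟩
  · choose z hz using h
    exact ⟨Finsupp.equivFunOnFinite.symm z, by ext i; simp [hz i]⟩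

lemma mem_of_tv_smul_mem {k : ℕ} {x : Msub C} (h : tv k • x ∈ tSub (k + 1) C) :
    x ∈ tSub (k + 1) C :=
  mem_tSub_iff.2 fun i => dvd_of_dvd_tv_mul (mem_tSub_iff.1 h i)

lemma mem_of_tv_pow_smul_mem {k n : ℕ} {x : Msub C} (h : tv k ^ n • x ∈ tSub (k + 1) C) :
    x ∈ tSub (k + 1) C := by
  induction n with
  | zero => simpa using h
  | succ n ih => exact ih (mem_of_tv_smul_mem (by rwa [smul_smul, ← pow_succ']))

lemma eq_zero_of_mem_tSub {k : ℕ} {x : Msub C} (h : x ∈ tSub k C) (h' : x ∈ tSub (k + 1) C) :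
    x = 0 := by
  ext i
  exact eq_zero_of_tv_dvd (mem_tSub_iff.1 h i) (mem_tSub_iff.1 h' i)

lemma dmap_mem_tSub {k : ℕ} {x : Msub C} (h : x ∈ tSub k C) : dmap C x ∈ tSub k C := by
  obtain ⟨z, rfl⟩ := mem_tSub.1 h
  rw [map_smul]
  exact smul_mem_tSub _ _

/-- Reduction modulo `(U, V)`. -/
noncomputable def red (C : PreCx) : Msub C →ₗ[ZMod 2] (Fin C.n → ZMod 2) :=
  AddMonoidHom.toZModLinearMap 2
    { toFun := fun x i => cst (x i)
      map_zero' := by ext; simp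
      map_add' := fun x y => by ext; simp }

lemma red_apply (x : Msub C) (i : Fin C.n) : red C x i = cst (x i) := rfl

lemma red_smul (r : RUV) (x : Msub C) : red C (r • x) = cst r • red C x := by
  ext i; simp [red_apply]

@[simp] lemma red_tv_smul (k : ℕ) (x : Msub C) : red C (tv k • x) = 0 := by
  rw [red_smul, cst_tv, zero_smul]

lemma exists_of_red_eq_zero (k : ℕ) {x : Msub C} (h : red C x = 0) :
    ∃ a b, x = tv k • a + tv (k + 1) • b := by
  have : ∀ i, ∃ a b, x i = tv k * a + tv (k + 1) * b := fun i =>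
    exists_of_cst_eq_zero k (congrFun h i)
  choose a b hab using this
  exact ⟨Finsupp.equivFunOnFinite.symm a, Finsupp.equivFunOnFinite.symm b,
    by ext i; simp [hab i]⟩

lemma red_surjective : Function.Surjective (red C) := by
  intro v
  refine ⟨Finsupp.equivFunOnFinite.symm fun i => algebraMap (ZMod 2) RUV (v i), ?_⟩
  ext i
  rw [red_apply]
  rcases zmod2_cases (v i) with h | h <;> simp [h]

/-- Two chains with the same reduction glue. -/
lemma exists_glue (k : ℕ) {x y : Msub C} (h : red C x = red C y) :
    ∃ z, red C z = red C x ∧ z - x ∈ tSub (k + 1) C ∧ z - y ∈ tSub k C := by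
  obtain ⟨a, b, hab⟩ := exists_of_red_eq_zero k (x := x - y) (by rw [map_sub, h, sub_self])
  refine ⟨x - tv (k + 1) • b, by simp, ?_, ?_⟩
  · rw [sub_sub_cancel_left]
    exact Submodule.neg_mem _ (smul_mem_tSub _ _)
  · have : x - tv (k + 1) • b - y = tv k • a := by
      rw [sub_right_comm, hab]; abel
    rw [this]
    exact smul_mem_tSub _ _

/-- The relation "`∂ x = Tⁿ y` modulo the other variable" between reductions. -/
noncomputable def arrowRel (C : PreCx) (k n : ℕ) :
    Submodule (ZMod 2) ((Fin C.n → ZMod 2) × (Fin C.n → ZMod 2)) :=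
  AddSubgroup.toZModSubmodule 2
    { carrier := {p | ∃ y x : Msub C, red C y = p.1 ∧ red C x = p.2 ∧
        dmap C x - tv k ^ n • y ∈ tSub (k + 1) C}
      zero_mem' := ⟨0, 0, by simp⟩
      add_mem' := by
        rintro p q ⟨y, x, hy, hx, h⟩ ⟨y', x', hy', hx', h'⟩
        refine ⟨y + y', x + x', by simp [hy, hy'], by simp [hx, hx'], ?_⟩
        rw [map_add, smul_add, add_sub_add_comm]
        exact Submodule.add_mem _ h h'
      neg_mem' := by
        rintro p ⟨y, x, hy, hx, h⟩
        refine ⟨-y, -x, by simp [hy], by simp [hx], ?_⟩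
        rw [map_neg, smul_neg, ← neg_sub']
        exact Submodule.neg_mem _ h }

lemma mem_arrowRel {k n : ℕ} {y x : Fin C.n → ZMod 2} :
    (y, x) ∈ arrowRel C k n ↔ ∃ y' x' : Msub C, red C y' = y ∧ red C x' = x ∧
      dmap C x' - tv k ^ n • y' ∈ tSub (k + 1) C := Iff.rfl

lemma arrowRel_add_two (k n : ℕ) : arrowRel C (k + 2) n = arrowRel C k n := by
  ext ⟨y, x⟩
  rw [mem_arrowRel, mem_arrowRel, tv_add_two, show k + 2 + 1 = k + 1 + 2 from rfl, tSub_add_two]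

lemma arrowRel_zero_right (k n : ℕ) (y : Fin C.n → ZMod 2) :
    (y, 0) ∈ arrowRel C k (n + 1) ↔ ∃ x, (y, x) ∈ arrowRel C k n := by
  simp only [mem_arrowRel]
  constructor
  · rintro ⟨y', x', hy, hx, h⟩
    obtain ⟨a, b, rfl⟩ := exists_of_red_eq_zero k hx
    refine ⟨red C a, y', a, hy, rfl, mem_of_tv_smul_mem (k := k) ?_⟩
    have e : tv k • (dmap C a - tv k ^ n • y') =
        (dmap C (tv k • a + tv (k + 1) • b) - tv k ^ (n + 1) • y') - tv (k + 1) • dmap C b := by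
      rw [map_add, map_smul, map_smul, smul_sub, smul_smul, ← pow_succ']
      abel
    rw [e]
    exact Submodule.sub_mem _ h (smul_mem_tSub _ _)
  · rintro ⟨x, y', x', hy, hx, h⟩
    refine ⟨y', tv k • x', hy, red_tv_smul _ _, ?_⟩
    rw [map_smul, pow_succ', mul_smul, ← smul_sub]
    exact Submodule.smul_mem _ _ h

lemma arrowRel_zero_left (k n : ℕ) (x : Fin C.n → ZMod 2) :
    (0, x) ∈ arrowRel C k n ↔ ∃ y, (y, x) ∈ arrowRel C k (n + 1) := by
  simp only [mem_arrowRel]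
  constructor
  · rintro ⟨y', x', hy, hx, h⟩
    obtain ⟨a, b, rfl⟩ := exists_of_red_eq_zero k hy
    refine ⟨red C a, a, x', rfl, hx, ?_⟩
    have e : dmap C x' - tv k ^ (n + 1) • a =
        (dmap C x' - tv k ^ n • (tv k • a + tv (k + 1) • b)) + tv k ^ n • tv (k + 1) • b := by
      rw [smul_add, smul_smul _ _ a, ← pow_succ]
      abel
    rw [e]
    exact Submodule.add_mem _ h (Submodule.smul_mem _ _ (smul_mem_tSub _ _))
  · rintro ⟨y, y', x', hy, hx, h⟩
    refine ⟨tv k • y', x', red_tv_smul _ _, hx, ?_⟩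
    rwa [smul_smul, ← pow_succ]

lemma arrowRel_trans (hd : ∀ x, dmap C (dmap C x) = 0) (k m : ℕ) (y x : Fin C.n → ZMod 2)
    (h : (y, x) ∈ arrowRel C k m) (n : ℕ) : (0, y) ∈ arrowRel C k n := by
  rw [mem_arrowRel] at h ⊢
  obtain ⟨y', x', hy, hx, h⟩ := h
  refine ⟨0, y', map_zero _, hy, ?_⟩
  rw [smul_zero, sub_zero]
  refine mem_of_tv_pow_smul_mem (n := m) ?_
  have h2 := dmap_mem_tSub h
  rw [map_sub, hd, zero_sub, map_smul] at h2
  exact (Submodule.neg_mem_iff _).1 h2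

/-- The arrows of a complex in one of the two variables. -/
noncomputable def arrows (C : PreCx) (hd : ∀ x, dmap C (dmap C x) = 0) (k : ℕ) :
    ArrowSystem (Fin C.n → ZMod 2) where
  rel := arrowRel C k
  rel_zero_right := arrowRel_zero_right k
  rel_zero_left := arrowRel_zero_left k
  rel_trans m n y x h := ⟨0, arrowRel_trans hd k m y x h n⟩

lemma arrows_add_two (hd : ∀ x, dmap C (dmap C x) = 0) (k : ℕ) :
    arrows C hd (k + 2) = arrows C hd k := by
  have : arrowRel C (k + 2) = arrowRel C k := funext (arrowRel_add_two k)
  simp only [arrows, this]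

lemma arrows_cyc_one (hd : ∀ x, dmap C (dmap C x) = 0) :
    (arrows C hd 0).cyc 1 = (arrows C hd 1).cyc 1 := by
  have aux : ∀ k, (arrows C hd k).cyc 1 ≤ (arrows C hd (k + 1)).cyc 1 := by
    intro k x hx
    obtain ⟨y, y', x', hy, hx, h⟩ := (ArrowSystem.mem_cyc _).1 hx
    obtain ⟨w, hw⟩ := mem_tSub.1 h
    refine (ArrowSystem.mem_cyc _).2 ⟨red C w, w, x', rfl, hx, ?_⟩
    rw [show k + 1 + 1 = k + 2 from rfl, tSub_add_two, pow_one, ← hw, sub_sub_cancel, pow_one]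
    exact smul_mem_tSub _ _
  refine le_antisymm (aux 0) ?_
  have := aux 1
  rwa [show 1 + 1 = 0 + 2 from rfl, arrows_add_two] at this

lemma arrows_bdr_zero (hd : ∀ x, dmap C (dmap C x) = 0) :
    (arrows C hd 0).bdr 0 = (arrows C hd 1).bdr 0 := by
  have aux : ∀ k l, (arrows C hd k).bdr 0 ≤ (arrows C hd l).bdr 0 := by
    intro k l y hy
    obtain ⟨x, y', x', hy, hx, h⟩ := (ArrowSystem.mem_bdr _).1 hy
    refine (ArrowSystem.mem_bdr _).2 ⟨x, dmap C x', x', ?_, hx, ?_⟩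
    · obtain ⟨w, hw⟩ := mem_tSub.1 h
      rw [pow_zero, one_smul] at hw
      rw [eq_add_of_sub_eq hw, map_add, red_tv_smul, zero_add, hy]
    · simp
  exact le_antisymm (aux _ _) (aux _ _)

/-- By Krull's intersection theorem a reduction which is the source of arbitrarily long arrows
lifts to a cycle. -/
lemma exists_cycle_lift (k : ℕ) (x : Fin C.n → ZMod 2)
    (h : ∀ n, ∃ y, (y, x) ∈ arrowRel C k n) :
    ∃ x' : Msub C, red C x' = x ∧ dmap C x' ∈ tSub (k + 1) C := by
  obtain ⟨x₀, hx₀⟩ := red_surjective x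
  set N : Submodule RUV (Msub C) := (tSub k C).map (dmap C) ⊔ tSub (k + 1) C with hN
  have hmem : N.mkQ (dmap C x₀) ∈
      (⨅ n : ℕ, Ideal.span {tv k} ^ n • ⊤ : Submodule RUV (Msub C ⧸ N)) := by
    refine (Submodule.mem_iInf _).2 fun n => ?_
    obtain ⟨_, y', x', -, hx', hd⟩ := h n
    obtain ⟨a, b, hab⟩ := exists_of_red_eq_zero k (x := x' - x₀) (by rw [map_sub, hx', hx₀, sub_self])
    have e : dmap C x₀ - tv k ^ n • y' =
        (dmap C x' - tv k ^ n • y') - dmap C (tv k • a) - tv (k + 1) • dmap C b := by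
      rw [← map_smul (dmap C) (tv (k + 1)), sub_sub _ _ (dmap C (tv (k + 1) • b)), ← map_add, ← hab,
        map_sub]
      abel
    have hq : N.mkQ (dmap C x₀) = tv k ^ n • N.mkQ y' := by
      rw [← map_smul, ← sub_eq_zero, ← map_sub, Submodule.mkQ_apply,
        Submodule.Quotient.mk_eq_zero, e]
      refine Submodule.sub_mem _ (Submodule.sub_mem _ (Submodule.mem_sup_right hd) ?_)
        (Submodule.mem_sup_right (smul_mem_tSub _ _))
      exact Submodule.mem_sup_left (Submodule.mem_map_of_mem (smul_mem_tSub _ _))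
    rw [hq]
    exact Submodule.smul_mem_smul (Ideal.pow_mem_pow (Ideal.mem_span_singleton_self _) n) trivial
  rw [Ideal.mem_iInf_smul_pow_eq_bot_iff] at hmem
  obtain ⟨⟨r, hr⟩, hrx⟩ := hmem
  obtain ⟨r', rfl⟩ := Ideal.mem_span_singleton'.1 hr
  have hmemN : dmap C x₀ - (r' * tv k) • dmap C x₀ ∈ N := by
    rw [← Submodule.Quotient.mk_eq_zero, ← Submodule.mkQ_apply, map_sub, map_smul, sub_eq_zero]
    exact hrx.symm
  obtain ⟨_, ⟨w, hw, rfl⟩, v, hv, hsum⟩ := Submodule.mem_sup.1 hmemN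
  obtain ⟨c, rfl⟩ := mem_tSub.1 hw
  refine ⟨x₀ - (r' * tv k) • x₀ - tv k • c, ?_, ?_⟩
  · simp [red_smul, hx₀]
  · rw [map_sub, map_sub, map_smul, ← hsum, add_sub_cancel_left]
    exact hv

lemma dmap_single (i j : Fin C.n) : dmap C (Finsupp.single i 1) j = C.dm i j := by
  rw [dmap, Finsupp.linearCombination_single, one_smul, Finsupp.finsetSum_apply,
    Finset.sum_eq_single j]
  · rw [Finsupp.single_eq_same]
  · intro l _ hl
    rw [Finsupp.single_eq_of_ne hl.symm]
  · simp

lemma eq_sum_single {n : ℕ} (x : Fin n →₀ RUV) :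
    x = ∑ i, x i • Finsupp.single i (1 : RUV) := by
  ext j
  rw [Finsupp.finsetSum_apply, Finset.sum_eq_single j]
  · simp
  · intro l _ hl
    rw [Finsupp.smul_apply, Finsupp.single_eq_of_ne hl.symm, smul_zero]
  · simp

lemma map_eq_sum {n : ℕ} {M : Type} [AddCommGroup M] [Module RUV M]
    (f : (Fin n →₀ RUV) →ₗ[RUV] M) (x : Fin n →₀ RUV) :
    f x = ∑ i, x i • f (Finsupp.single i (1 : RUV)) := by
  conv_lhs => rw [eq_sum_single x]
  rw [map_sum]
  exact Finset.sum_congr rfl fun i _ => map_smul _ _ _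

lemma dmap_apply (x : Msub C) (j : Fin C.n) : dmap C x j = ∑ i, x i * C.dm i j := by
  rw [map_eq_sum (dmap C) x, Finsupp.finsetSum_apply]
  refine Finset.sum_congr rfl fun i _ => ?_
  rw [Finsupp.smul_apply, dmap_single, smul_eq_mul]

lemma dmap_dmap_eq_zero_iff :
    (∀ x, dmap C (dmap C x) = 0) ↔ ∀ i k, ∑ j, C.dm i j * C.dm j k = 0 := by
  constructor
  · intro h i k
    have := DFunLike.congr_fun (h (Finsupp.single i 1)) k
    rw [dmap_apply] at this
    simp only [dmap_single] at this
    exact this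
  · intro h x
    rw [map_eq_sum (dmap C) x, map_sum]
    refine Finset.sum_eq_zero fun i _ => ?_
    rw [map_smul]
    have : dmap C (dmap C (Finsupp.single i 1)) = 0 := by
      ext k
      rw [dmap_apply]
      simp only [dmap_single]
      exact h i k
    rw [this, smul_zero]

/-- The complex with the transposed differential. -/
abbrev transposeCx (C : PreCx) : PreCx := ⟨C.n, C.gr, fun i j => C.dm j i⟩

lemma transposeCx_dmap_dmap (hd : ∀ x, dmap C (dmap C x) = 0) (x : Msub (transposeCx C)) :
    dmap (transposeCx C) (dmap (transposeCx C) x) = 0 := by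
  refine dmap_dmap_eq_zero_iff.2 (fun i k => ?_) x
  refine Eq.trans (Finset.sum_congr rfl fun j _ => ?_) (dmap_dmap_eq_zero_iff.1 hd k i)
  exact mul_comm _ _

/-- The coordinate vector of a functional. -/
def dualVec {n : ℕ} (f : Module.Dual (ZMod 2) (Fin n → ZMod 2)) : Fin n → ZMod 2 :=
  fun i => f (Pi.single i 1)

lemma cst_algebraMap (a : ZMod 2) : cst (algebraMap (ZMod 2) RUV a) = a := by
  rcases zmod2_cases a with rfl | rfl <;> simp

lemma red_single (i : Fin C.n) : red C (Finsupp.single i 1) = Pi.single i 1 := by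
  ext j
  rw [red_apply]
  rcases eq_or_ne j i with rfl | h
  · simp
  · rw [Finsupp.single_eq_of_ne h, Pi.single_eq_of_ne h, map_zero]

lemma exists_dual_factor {A B : Type} [AddCommGroup A] [AddCommGroup B] [Module (ZMod 2) A]
    [Module (ZMod 2) B] (φ : A →ₗ[ZMod 2] B) (ψ : A →ₗ[ZMod 2] ZMod 2)
    (h : ∀ a, φ a = 0 → ψ a = 0) : ∃ l : B →ₗ[ZMod 2] ZMod 2, ∀ a, l (φ a) = ψ a := by
  have : ψ ∈ LinearMap.range φ.dualMap := by
    rw [LinearMap.range_dualMap_eq_dualAnnihilator_ker, Submodule.mem_dualAnnihilator]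
    exact fun a ha => h a ha
  obtain ⟨l, rfl⟩ := this
  exact ⟨l, fun a => rfl⟩

lemma exists_arrow_functional (k b : ℕ) (f g : Module.Dual (ZMod 2) (Fin C.n → ZMod 2))
    (h : ∀ y x, (y, x) ∈ arrowRel C k b → f y = g x) :
    ∃ l : Msub C →+ ZMod 2, (∀ y, l (tv k ^ b • y) = f (red C y)) ∧
      (∀ x, l (dmap C x) = g (red C x)) ∧ (∀ a, l (tv k ^ (b + 1) • a) = 0) ∧
      ∀ c, l (tv (k + 1) • c) = 0 := by
  let φ : (Msub C × Msub C) × (Msub C × Msub C) →+ Msub C :=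
    AddMonoidHom.mk' (fun p => (tv k ^ b • p.1.1 - dmap C p.1.2) +
      (tv k ^ (b + 1) • p.2.1 + tv (k + 1) • p.2.2)) (by
        intro p q
        simp only [Prod.fst_add, Prod.snd_add, smul_add, map_add]
        abel)
  let ψ : (Msub C × Msub C) × (Msub C × Msub C) →+ ZMod 2 :=
    AddMonoidHom.mk' (fun p => f (red C p.1.1) - g (red C p.1.2)) (by
        intro p q
        simp only [Prod.fst_add, Prod.snd_add, map_add]
        abel)
  obtain ⟨l, hl⟩ := exists_dual_factor (φ.toZModLinearMap 2) (ψ.toZModLinearMap 2) (by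
    rintro ⟨⟨y, x⟩, a, c⟩ h0
    have h0 : (tv k ^ b • y - dmap C x) + (tv k ^ (b + 1) • a + tv (k + 1) • c) = 0 := h0
    change f (red C y) - g (red C x) = 0
    have hm : (red C (y + tv k • a), red C x) ∈ arrowRel C k b := by
      refine mem_arrowRel.2 ⟨_, _, rfl, rfl, ?_⟩
      have : dmap C x - tv k ^ b • (y + tv k • a) = tv (k + 1) • c := by
        rw [smul_add, smul_smul, ← pow_succ, ← sub_eq_zero, ← neg_eq_zero, ← h0]
        abel
      rw [this]
      exact smul_mem_tSub _ _
    have := h _ _ hm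
    rw [map_add, red_tv_smul, add_zero] at this
    rw [this, sub_self])
  have hl' : ∀ y x a c, l ((tv k ^ b • y - dmap C x) + (tv k ^ (b + 1) • a + tv (k + 1) • c)) =
      f (red C y) - g (red C x) := fun y x a c => hl ((y, x), (a, c))
  refine ⟨l.toAddMonoidHom, fun y => ?_, fun x => ?_, fun a => ?_, fun c => ?_⟩
  · have := hl' y 0 0 0
    simp only [map_zero, sub_zero, smul_zero, add_zero] at this
    exact this
  · have := hl' 0 x 0 0
    simp only [map_zero, zero_sub, smul_zero, add_zero, map_neg, neg_inj] at this
    exact this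
  · have := hl' 0 0 a 0
    simp only [map_zero, sub_zero, smul_zero, add_zero, zero_add] at this
    exact this
  · have := hl' 0 0 0 c
    simp only [map_zero, sub_zero, smul_zero, zero_add] at this
    exact this

section truncation

variable {M : Type} [AddCommGroup M] [Module RUV M] (l : M →+ ZMod 2) (k b : ℕ)

/-- The functional with values in `R/(T^{b+1}, T')` attached to an additive functional. -/
noncomputable def truncFun (c : M) : RUV :=
  ∑ j ∈ Finset.range (b + 1), algebraMap (ZMod 2) RUV (l (tv k ^ j • c)) * tv k ^ (b - j)

lemma truncFun_add (c d : M) : truncFun l k b (c + d) = truncFun l k b c + truncFun l k b d := by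
  simp only [truncFun, smul_add, map_add, add_mul, Finset.sum_add_distrib]

lemma truncFun_zero : truncFun l k b 0 = 0 := by
  simp only [truncFun, smul_zero, map_zero, zero_mul, Finset.sum_const_zero]

lemma cst_truncFun (c : M) : cst (truncFun l k b c) = l (tv k ^ b • c) := by
  rw [truncFun, map_sum, Finset.sum_eq_single b]
  · simp [cst_algebraMap]
  · intro j hj hjb
    rw [map_mul, map_pow, cst_tv, zero_pow, mul_zero]
    have := Finset.mem_range.1 hj
    omega
  · simp

variable {l k b}

lemma truncFun_smul_sub_mem (h : ∀ a, l (tv k ^ (b + 1) • a) = 0) (h' : ∀ c, l (tv (k + 1) • c) = 0)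
    (r : RUV) (c : M) :
    truncFun l k b (r • c) - r * truncFun l k b c ∈ Ideal.span {tv k ^ (b + 1), tv (k + 1)} := by
  induction r using ruv_induction_tv k generalizing c with
  | h0 => simp [truncFun_zero]
  | h1 => simp
  | hadd r s hr hs =>
    rw [add_smul, truncFun_add, add_mul, add_sub_add_comm]
    exact Ideal.add_mem _ (hr c) (hs c)
  | hT r hr =>
    have e : truncFun l k b ((tv k * r) • c) - tv k * truncFun l k b (r • c) ∈
        Ideal.span {tv k ^ (b + 1), tv (k + 1)} := by
      have : truncFun l k b ((tv k * r) • c) - tv k * truncFun l k b (r • c) =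
          -(algebraMap (ZMod 2) RUV (l (r • c)) * tv k ^ (b + 1)) := by
        rw [truncFun, truncFun, Finset.sum_range_succ, Finset.sum_range_succ', mul_add,
          Finset.mul_sum]
        have h1 : ∀ j ∈ Finset.range b,
            tv k * (algebraMap (ZMod 2) RUV (l (tv k ^ (j + 1) • r • c)) * tv k ^ (b - (j + 1))) =
            algebraMap (ZMod 2) RUV (l (tv k ^ j • (tv k * r) • c)) * tv k ^ (b - j) := by
          intro j hj
          have hj := Finset.mem_range.1 hj
          rw [mul_left_comm, ← pow_succ', show b - (j + 1) + 1 = b - j by omega, pow_succ,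
            mul_smul (tv k) r c, mul_smul (tv k ^ j) (tv k)]
        rw [Finset.sum_congr rfl h1, mul_smul (tv k) r c, smul_smul (tv k ^ b), ← pow_succ, h]
        simp only [map_zero, zero_mul, add_zero, pow_zero, one_smul, Nat.sub_zero]
        ring
      rw [this]
      exact Ideal.neg_mem_iff _ |>.2 (Ideal.mul_mem_left _ _ (Ideal.subset_span (by simp)))
    have := Ideal.add_mem _ e (Ideal.mul_mem_left _ (tv k) (hr c))
    convert this using 1
    ring
  | hT' r _ =>
    have : truncFun l k b ((tv (k + 1) * r) • c) = 0 := by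
      refine Finset.sum_eq_zero fun j _ => ?_
      rw [mul_smul, smul_comm, h', map_zero, zero_mul]
    rw [this, zero_sub, mul_assoc]
    exact Ideal.neg_mem_iff _ |>.2 (Ideal.mul_mem_right _ _ (Ideal.subset_span (by simp)))

end truncation

/-- Functionals compatible with the arrows of a complex are arrows of the dual complex. -/
lemma dualVec_mem_arrowRel (k b : ℕ) (f g : Module.Dual (ZMod 2) (Fin C.n → ZMod 2))
    (h : ∀ y x, (y, x) ∈ arrowRel C k b → f y = g x) :
    (dualVec g, dualVec f) ∈ arrowRel (transposeCx C) k b := by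
  obtain ⟨l, hf, hg, h1, h2⟩ := exists_arrow_functional k b f g h
  let x' : Msub (transposeCx C) :=
    Finsupp.equivFunOnFinite.symm fun i : Fin C.n => truncFun l k b (Finsupp.single i 1)
  have key : ∀ j : Fin C.n, ∃ a d, dmap (transposeCx C) x' j - algebraMap (ZMod 2) RUV (dualVec g j) *
      tv k ^ b = a * tv k ^ (b + 1) + d * tv (k + 1) := by
    intro j
    have hsum : ∀ s : Finset (Fin C.n),
        truncFun l k b (∑ i ∈ s, C.dm j i • Finsupp.single i (1 : RUV)) -
          ∑ i ∈ s, C.dm j i * truncFun l k b (Finsupp.single i (1 : RUV)) ∈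
        Ideal.span {tv k ^ (b + 1), tv (k + 1)} := by
      intro s
      induction s using Finset.induction_on with
      | empty => simp [truncFun_zero]
      | insert i s hi ih =>
        rw [Finset.sum_insert hi, Finset.sum_insert hi, truncFun_add, add_sub_add_comm]
        exact Ideal.add_mem _ (truncFun_smul_sub_mem h1 h2 _ _) ih
    have e1 : ∑ i, C.dm j i • Finsupp.single i (1 : RUV) = dmap C (Finsupp.single j 1) := by
      rw [eq_sum_single (dmap C (Finsupp.single j 1))]
      simp only [dmap_single]
    have e2 : ∑ i, C.dm j i * truncFun l k b (Finsupp.single i (1 : RUV)) =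
        dmap (transposeCx C) x' j := by
      rw [dmap_apply]
      exact Finset.sum_congr rfl fun i _ => mul_comm _ _
    have e3 : truncFun l k b (dmap C (Finsupp.single j 1)) =
        algebraMap (ZMod 2) RUV (dualVec g j) * tv k ^ b := by
      rw [truncFun, Finset.sum_eq_single 0]
      · rw [pow_zero, one_smul, hg, red_single, Nat.sub_zero]
        rfl
      · intro i _ hi
        rw [← map_smul, hg, red_smul, map_pow, cst_tv, zero_pow hi, zero_smul, map_zero, map_zero,
          zero_mul]
      · simp
    have := hsum Finset.univ
    rw [e1, e2, e3, ← neg_sub, Ideal.neg_mem_iff] at this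
    obtain ⟨a, d, had⟩ := Ideal.mem_span_pair.1 this
    exact ⟨a, d, had.symm⟩
  choose a d had using key
  refine mem_arrowRel.2 ⟨Finsupp.equivFunOnFinite.symm fun j : Fin C.n =>
    algebraMap (ZMod 2) RUV (dualVec g j) + a j * tv k, x', ?_, ?_, ?_⟩
  · ext j
    rw [red_apply, Finsupp.equivFunOnFinite_symm_apply_apply, map_add, map_mul, cst_tv, mul_zero,
      add_zero, cst_algebraMap]
  · ext j
    rw [red_apply, Finsupp.equivFunOnFinite_symm_apply_apply, cst_truncFun, hf, red_single]
    rfl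
  · refine mem_tSub_iff.2 fun j => ⟨d j, ?_⟩
    rw [Finsupp.sub_apply, Finsupp.smul_apply, Finsupp.equivFunOnFinite_symm_apply_apply,
      smul_eq_mul]
    linear_combination had j

lemma dualVec_mem_step (hd : ∀ x, dmap C (dmap C x) = 0) (k : ℕ) {b : ℤ} (hb : b ≠ 0)
    {f f' : Module.Dual (ZMod 2) (Fin C.n → ZMod 2)} (h : (arrows C hd k).CoStep b f f') :
    (dualVec f, dualVec f') ∈ (arrows (transposeCx C) (transposeCx_dmap_dmap hd) k).step (-b) := by
  rcases lt_or_gt_of_ne hb with hb | hb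
  · rw [ArrowSystem.mem_step_of_pos _ (by omega), Int.natAbs_neg]
    exact dualVec_mem_arrowRel k _ _ _ fun y x hyx =>
      (h x y ((ArrowSystem.mem_step_of_neg _ hb).2 hyx)).symm
  · rw [ArrowSystem.mem_step_of_neg _ (by omega), Int.natAbs_neg]
    exact dualVec_mem_arrowRel k _ _ _ fun y x hyx =>
      h y x ((ArrowSystem.mem_step_of_pos _ hb).2 hyx)

lemma exists_dualVec_lift (hd : ∀ x, dmap C (dmap C x) = 0) (k : ℕ)
    {f : Module.Dual (ZMod 2) (Fin C.n → ZMod 2)} (h : ∀ y ∈ (arrows C hd k).bdrInf, f y = 0) :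
    ∃ x' : Msub (transposeCx C), red (transposeCx C) x' = dualVec f ∧
      dmap (transposeCx C) x' ∈ tSub (k + 1) (transposeCx C) := by
  refine exists_cycle_lift k _ fun n => ⟨_, dualVec_mem_arrowRel k n f 0 fun y x hyx => ?_⟩
  rw [h y ((ArrowSystem.mem_bdrInf _).2 ⟨n, (ArrowSystem.mem_bdr _).2 ⟨x, hyx⟩⟩)]
  rfl

section stdSum

variable {M : Type} [AddCommGroup M] [Module RUV M]

/-- The outgoing arrow at the vertex `i` along the edge from `i` to `i + 1`. -/
noncomputable def edgeNext (n : ℕ) (b : ℕ → ℤ) (u : ℕ → M) (i : ℕ) : M :=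
  if i < n ∧ b i < 0 then tv i ^ (b i).natAbs • u (i + 1) else 0

/-- The outgoing arrow at the vertex `i` along the edge from `i` to `i - 1`. -/
noncomputable def edgePrev (b : ℕ → ℤ) (u : ℕ → M) : ℕ → M
  | 0 => 0
  | j + 1 => if 0 < b j then tv j ^ (b j).natAbs • u j else 0

/-- The differential of a standard complex evaluated on a sequence. -/
noncomputable def stdSum (n : ℕ) (b : ℕ → ℤ) (u : ℕ → M) (i : ℕ) : M :=
  edgeNext n b u i + edgePrev b u i

lemma stdSum_sub (n : ℕ) (b : ℕ → ℤ) (u v : ℕ → M) (i : ℕ) :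
    stdSum n b (fun j => u j - v j) i = stdSum n b u i - stdSum n b v i := by
  have h1 : edgeNext n b (fun j => u j - v j) i = edgeNext n b u i - edgeNext n b v i := by
    unfold edgeNext
    split_ifs
    · rw [smul_sub]
    · rw [sub_zero]
  have h2 : edgePrev b (fun j => u j - v j) i = edgePrev b u i - edgePrev b v i := by
    cases i with
    | zero => simp [edgePrev]
    | succ j =>
      simp only [edgePrev]
      split_ifs
      · rw [smul_sub]
      · rw [sub_zero]
  rw [stdSum, stdSum, stdSum, h1, h2, add_sub_add_comm]

lemma edgeNext_mem {n : ℕ} {b : ℕ → ℤ} {u : ℕ → M} {i : ℕ} {N : Submodule RUV M}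
    (h : i < n → u (i + 1) ∈ N) : edgeNext n b u i ∈ N := by
  unfold edgeNext
  split_ifs with hi
  · exact N.smul_mem _ (h hi.1)
  · exact N.zero_mem

lemma edgePrev_mem {b : ℕ → ℤ} {u : ℕ → M} {i : ℕ} {N : Submodule RUV M}
    (h : 0 < i → u (i - 1) ∈ N) : edgePrev b u i ∈ N := by
  cases i with
  | zero => exact N.zero_mem
  | succ j =>
    simp only [edgePrev]
    split_ifs
    · exact N.smul_mem _ (h (Nat.succ_pos _))
    · exact N.zero_mem

variable (n : ℕ) (b : ℕ → ℤ)

lemma getD_map_range {i : ℕ} (hi : i < n) : ((List.range n).map b).getD i 0 = b i := by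
  simp [List.getD, hi]

lemma stdDm_map_range (i j : Fin (((List.range n).map b).length + 1)) :
    stdDm ((List.range n).map b) i j =
      (if (j : ℕ) = i + 1 then (if (i : ℕ) < n ∧ b i < 0 then tv i ^ (b i).natAbs else 0) else 0) +
      (if (i : ℕ) = j + 1 then (if 0 < b j then tv j ^ (b j).natAbs else 0) else 0) := by
  have hi : (i : ℕ) < n + 1 := by simpa using i.2
  have hj : (j : ℕ) < n + 1 := by simpa using j.2
  rw [stdDm]
  by_cases h1 : (j : ℕ) = i + 1
  · have hin : (i : ℕ) < n := by omega
    have h2 : ¬ (i : ℕ) = j + 1 := by omega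
    have e := getD_map_range n b hin
    rw [if_pos h1, if_neg h2, add_zero]
    by_cases hb : b i < 0
    · have c1 : (j : ℕ) = i + 1 ∧ ((List.range n).map b).getD i 0 < 0 := ⟨h1, by rwa [e]⟩
      have c2 : (i : ℕ) < n ∧ b i < 0 := ⟨hin, hb⟩
      rw [if_pos c1, if_pos c2, e]
      rfl
    · rw [if_neg (fun h => hb (e ▸ h.2)), if_neg (fun h => h2 h.1), if_neg (fun h => hb h.2)]
  · rw [if_neg (fun h => h1 h.1), if_neg h1, zero_add]
    by_cases h2 : (i : ℕ) = j + 1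
    · have hjn : (j : ℕ) < n := by omega
      have e := getD_map_range n b hjn
      rw [if_pos h2]
      by_cases hb : 0 < b j
      · have c1 : (i : ℕ) = j + 1 ∧ 0 < ((List.range n).map b).getD j 0 := ⟨h2, by rwa [e]⟩
        rw [if_pos c1, if_pos hb, e]
        rfl
      · rw [if_neg (fun h => hb (e ▸ h.2)), if_neg hb]
    · rw [if_neg (fun h => h2 h.1), if_neg h2]

lemma sum_fin_ite {m : ℕ} (u : ℕ → M) (a : ℕ) (r : RUV) :
    ∑ j : Fin m, (if (j : ℕ) = a then r else 0) • u j = if a < m then r • u a else 0 := by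
  split_ifs with h
  · rw [Finset.sum_eq_single ⟨a, h⟩]
    · simp
    · intro j _ hj
      rw [if_neg (fun h' => hj (Fin.ext h')), zero_smul]
    · simp
  · refine Finset.sum_eq_zero fun j _ => ?_
    rw [if_neg (by omega), zero_smul]

lemma sum_next_smul {m : ℕ} (u : ℕ → M) (i : ℕ) {P : Prop} [Decidable P]
    (hP : P ↔ i < n ∧ b i < 0) (hm : i < n → i + 1 < m) :
    ∑ j : Fin m, (if (j : ℕ) = i + 1 then (if P then tv i ^ (b i).natAbs else 0) else 0) • u j =
      edgeNext n b u i := by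
  rw [sum_fin_ite, edgeNext]
  by_cases h : P
  · rw [if_pos h, if_pos (hm (hP.1 h).1), if_pos (hP.1 h)]
  · rw [if_neg h, if_neg (fun h' => h (hP.2 h')), zero_smul, ite_self]

lemma sum_prev_smul {m : ℕ} (u : ℕ → M) (i : ℕ) (P : ℕ → Prop) [DecidablePred P]
    (hP : ∀ j < i, P j ↔ 0 < b j) (hm : i ≤ m) :
    ∑ j : Fin m, (if i = (j : ℕ) + 1 then (if P j then tv j ^ (b j).natAbs else 0) else 0) • u j =
      edgePrev b u i := by
  rcases i with _ | k
  · exact Finset.sum_eq_zero fun j _ => by simp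
  · have : ∀ j : Fin m,
        (if k + 1 = (j : ℕ) + 1 then (if P j then tv j ^ (b j).natAbs else 0) else 0) • u j =
        (if (j : ℕ) = k then (if P k then tv k ^ (b k).natAbs else 0) else 0) • u j := by
      intro j
      by_cases hj : (j : ℕ) = k
      · simp [hj]
      · rw [if_neg (by omega), if_neg hj]
    rw [Finset.sum_congr rfl fun j _ => this j, sum_fin_ite, if_pos (by omega)]
    simp only [edgePrev]
    by_cases h : P k
    · rw [if_pos h, if_pos ((hP k (Nat.lt_succ_self k)).1 h)]
    · rw [if_neg h, if_neg (fun h' => h ((hP k (Nat.lt_succ_self k)).2 h')), zero_smul]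

lemma sum_stdDm_smul (u : ℕ → M) (i : Fin (((List.range n).map b).length + 1)) :
    ∑ j, stdDm ((List.range n).map b) i j • u j = stdSum n b u i := by
  have hlen : ((List.range n).map b).length + 1 = n + 1 := by simp
  simp only [stdDm_map_range, add_smul, Finset.sum_add_distrib]
  rw [stdSum, sum_next_smul n b u i Iff.rfl (by omega),
    sum_prev_smul b u i (fun j => 0 < b j) (fun _ _ => Iff.rfl) (by omega)]

lemma sum_stdDm_transpose_smul (u : ℕ → M) (i : Fin (((List.range n).map b).length + 1)) :
    ∑ j, stdDm ((List.range n).map b) j i • u j = stdSum n (fun k => -b k) u i := by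
  have hlen : ((List.range n).map b).length + 1 = n + 1 := by simp
  have hi := i.2
  simp only [stdDm_map_range, add_smul, Finset.sum_add_distrib]
  have h1 := sum_prev_smul (m := ((List.range n).map b).length + 1) (fun k => -b k) u i
    (fun j => j < n ∧ b j < 0) (fun j hj => by omega) (by omega)
  have h2 : ∑ j : Fin (((List.range n).map b).length + 1),
      (if (j : ℕ) = i + 1 then (if 0 < b i then tv i ^ (b i).natAbs else 0) else 0) • u j =
      edgeNext n (fun k => -b k) u i := by
    rw [sum_fin_ite, edgeNext]
    simp only [Int.natAbs_neg]
    split_ifs <;> first | rfl | omega | simp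
  simp only [Int.natAbs_neg] at h1
  rw [stdSum, h1, h2, add_comm]

end stdSum

/-- Paths of arrows in one variable lift to that variable. -/
lemma exists_side_lift (hd : ∀ x, dmap C (dmap C x) = 0) {n : ℕ} (hn : Even n) {b : ℕ → ℤ}
    (hb : ∀ i < n, b i ≠ 0) {ξ : ℕ → Fin C.n → ZMod 2} {s : ℕ} (hs : s < 2)
    (hstep : ∀ i < n, (ξ i, ξ (i + 1)) ∈ (arrows C hd i).step (b i)) {z w : Msub C}
    (hz : red C z = ξ 0) (hzd : dmap C z ∈ tSub 0 C) (hw : red C w = ξ n)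
    (hwd : dmap C w ∈ tSub 1 C) :
    ∃ u : ℕ → Msub C, ∀ i ≤ n, red C (u i) = ξ i ∧
      dmap C (u i) - stdSum n b u i ∈ tSub (s + 1) C := by
  have key : ∀ i, ∃ p q : Msub C, i < n → red C p = ξ i ∧ red C q = ξ (i + 1) ∧
      dmap C p - (if b i < 0 then tv i ^ (b i).natAbs • q else 0) ∈ tSub (i + 1) C ∧
      dmap C q - (if 0 < b i then tv i ^ (b i).natAbs • p else 0) ∈ tSub (i + 1) C := by
    intro i
    by_cases hi : i < n
    swap
    · exact ⟨0, 0, fun h => absurd h hi⟩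
    have aux : ∀ (m : ℕ) (y x : Msub C), dmap C x - tv i ^ m • y ∈ tSub (i + 1) C →
        dmap C y ∈ tSub (i + 1) C := by
      intro m y x h
      refine mem_of_tv_pow_smul_mem (n := m) ?_
      have h2 := dmap_mem_tSub h
      rw [map_sub, hd, zero_sub, map_smul] at h2
      exact (Submodule.neg_mem_iff _).1 h2
    rcases lt_or_gt_of_ne (hb i hi) with h | h
    · obtain ⟨y, x, hy, hx, hxy⟩ := mem_arrowRel.1
        ((ArrowSystem.mem_step_of_neg _ h).1 (hstep i hi))
      refine ⟨x, y, fun _ => ⟨hx, hy, ?_, ?_⟩⟩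
      · rwa [if_pos h]
      · rw [if_neg h.not_gt, sub_zero]
        exact aux _ _ _ hxy
    · obtain ⟨y, x, hy, hx, hxy⟩ := mem_arrowRel.1
        ((ArrowSystem.mem_step_of_pos _ h).1 (hstep i hi))
      refine ⟨y, x, fun _ => ⟨hy, hx, ?_, ?_⟩⟩
      · rw [if_neg h.not_gt, sub_zero]
        exact aux _ _ _ hxy
      · rwa [if_pos h]
  choose p q hpq using key
  have htv : ∀ i, i % 2 ≠ s → tv i = tv (s + 1) := by
    intro i hi
    have : i % 2 = (s + 1) % 2 := by omega
    simp only [tv, this]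
  have htS : ∀ i, i % 2 = s → tSub (i + 1) C = tSub (s + 1) C := by
    intro i hi
    have : (i + 1) % 2 = (s + 1) % 2 := by omega
    simp only [tSub, tv, this]
  have hside : ∀ i, i % 2 ≠ s → i < n → ∀ c : Msub C, tv i ^ (b i).natAbs • c ∈ tSub (s + 1) C := by
    intro i hi hin c
    have : (b i).natAbs ≠ 0 := Int.natAbs_ne_zero.2 (hb i hin)
    obtain ⟨m, hm⟩ := Nat.exists_eq_succ_of_ne_zero this
    rw [hm, pow_succ', mul_smul, htv i hi]
    exact smul_mem_tSub _ _
  have hnext : ∀ i, i % 2 ≠ s → ∀ u : ℕ → Msub C, edgeNext n b u i ∈ tSub (s + 1) C := by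
    intro i hi u
    unfold edgeNext
    split_ifs with h
    · exact hside i hi h.1 _
    · exact Submodule.zero_mem _
  have hprev : ∀ i, i % 2 = s → i ≤ n → ∀ u : ℕ → Msub C, edgePrev b u i ∈ tSub (s + 1) C := by
    intro i hi hin u
    cases i with
    | zero => exact Submodule.zero_mem _
    | succ j =>
      simp only [edgePrev]
      split_ifs
      · exact hside j (by omega) (by omega) _
      · exact Submodule.zero_mem _
  have hn2 : n % 2 = 0 := Nat.even_iff.1 hn
  refine ⟨fun i => if i % 2 = s then (if i < n then p i else w) else
    (if i = 0 then z else q (i - 1)), fun i hi => ?_⟩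
  beta_reduce
  by_cases his : i % 2 = s
  · rw [if_pos his]
    by_cases hin : i < n
    · rw [if_pos hin]
      refine ⟨(hpq i hin).1, ?_⟩
      rw [stdSum, ← sub_sub]
      refine Submodule.sub_mem _ ?_ (hprev i his hi _)
      have := (hpq i hin).2.2.1
      rw [htS i his] at this
      convert this using 2
      rw [edgeNext, if_neg (show ¬ (i + 1) % 2 = s by omega), if_neg (Nat.succ_ne_zero i),
        Nat.add_sub_cancel]
      simp only [hin, true_and]
    · have hin' : i = n := by omega
      rw [if_neg hin, hin']
      refine ⟨hw, ?_⟩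
      rw [stdSum, ← sub_sub]
      refine Submodule.sub_mem _ (Submodule.sub_mem _ ?_ ?_) (hprev n (hin' ▸ his) le_rfl _)
      · have : s = 0 := by omega
        rw [this]
        exact hwd
      · rw [edgeNext, if_neg (by omega)]
        exact Submodule.zero_mem _
  · rw [if_neg his]
    cases i with
    | zero =>
      have : s = 1 := by omega
      rw [if_pos rfl]
      refine ⟨hz, ?_⟩
      rw [stdSum, ← sub_sub]
      refine Submodule.sub_mem _ (Submodule.sub_mem _ ?_ (hnext 0 his _)) (Submodule.zero_mem _)
      rw [this, show 1 + 1 = 0 + 2 from rfl, tSub_add_two]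
      exact hzd
    | succ j =>
      rw [if_neg (Nat.succ_ne_zero j), Nat.add_sub_cancel]
      have hjs : j % 2 = s := by omega
      have hjn : j < n := by omega
      refine ⟨(hpq j hjn).2.1, ?_⟩
      rw [stdSum, add_comm (edgeNext _ _ _ _), ← sub_sub]
      refine Submodule.sub_mem _ ?_ (hnext _ his _)
      have := (hpq j hjn).2.2.2
      rw [htS j hjs] at this
      convert this using 2
      simp only [edgePrev, hjs, hjn, if_true]

/-- Paths of arrows from the `V`-tower to the `U`-tower lift to the chain level. -/
lemma exists_path_lift (hd : ∀ x, dmap C (dmap C x) = 0) {n : ℕ} (hn : Even n) {b : ℕ → ℤ}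
    (hb : ∀ i < n, b i ≠ 0) {ξ : ℕ → Fin C.n → ZMod 2}
    (hstep : ∀ i < n, (ξ i, ξ (i + 1)) ∈ (arrows C hd i).step (b i)) {z w : Msub C}
    (hz : red C z = ξ 0) (hzd : dmap C z ∈ tSub 0 C) (hw : red C w = ξ n)
    (hwd : dmap C w ∈ tSub 1 C) :
    ∃ c : ℕ → Msub C, ∀ i ≤ n, red C (c i) = ξ i ∧ dmap C (c i) = stdSum n b c i := by
  obtain ⟨u, hu⟩ := exists_side_lift hd hn hb (s := 0) (by norm_num) hstep hz hzd hw hwd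
  obtain ⟨v, hv⟩ := exists_side_lift hd hn hb (s := 1) (by norm_num) hstep hz hzd hw hwd
  have hg : ∀ i, ∃ c : Msub C, i ≤ n → red C c = ξ i ∧ c - u i ∈ tSub 1 C ∧ c - v i ∈ tSub 0 C := by
    intro i
    by_cases hi : i ≤ n
    · obtain ⟨c, hc, hcu, hcv⟩ := exists_glue 0 (x := u i) (y := v i)
        (by rw [(hu i hi).1, (hv i hi).1])
      exact ⟨c, fun _ => ⟨hc.trans (hu i hi).1, hcu, hcv⟩⟩
    · exact ⟨0, fun h => absurd h hi⟩
  choose c hc using hg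
  refine ⟨c, fun i hi => ⟨(hc i hi).1, sub_eq_zero.1 ?_⟩⟩
  have main : ∀ (k : ℕ) (u : ℕ → Msub C), (∀ i ≤ n, c i - u i ∈ tSub k C) →
      dmap C (u i) - stdSum n b u i ∈ tSub k C → dmap C (c i) - stdSum n b c i ∈ tSub k C := by
    intro k u h h'
    have e : dmap C (c i) - stdSum n b c i = dmap C (c i - u i) -
        stdSum n b (fun j => c j - u j) i + (dmap C (u i) - stdSum n b u i) := by
      rw [stdSum_sub, map_sub]
      abel
    rw [e]
    refine Submodule.add_mem _ (Submodule.sub_mem _ (dmap_mem_tSub (h i hi)) ?_) h'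
    exact Submodule.add_mem _ (edgeNext_mem fun h' => h _ h')
      (edgePrev_mem fun h' => h _ (by omega))
  refine eq_zero_of_mem_tSub (k := 0) (main 0 v (fun i hi => (hc i hi).2.2) ?_)
    (main 1 u (fun i hi => (hc i hi).2.1) (hu i hi).2)
  have := (hv i hi).2
  rwa [show 1 + 1 = 0 + 2 from rfl, tSub_add_two] at this

end complexes

/-! ### Homogeneous components -/

lemma ruv_add_self (r : RUV) : r + r = 0 := by
  have h : (2 : RUV) = 0 := by
    have : algebraMap (ZMod 2) RUV 2 = 2 := map_ofNat _ 2
    rw [← this, show (2 : ZMod 2) = 0 from rfl, map_zero]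
  rw [← two_mul, h, zero_mul]

lemma isHomog_zero (p q : ℤ) : IsHomog 0 p q := Or.inl rfl

lemma isHomog_one : IsHomog 1 0 0 := Or.inr (Or.inl ⟨0, by simp⟩)

lemma isHomog_Uv : IsHomog Uv (-2) 0 := Or.inr (Or.inl ⟨1, by simp⟩)

lemma isHomog_Vv : IsHomog Vv 0 (-2) := Or.inr (Or.inr ⟨1, by simp⟩)

lemma IsHomog.add {r s : RUV} {p q : ℤ} (hr : IsHomog r p q) (hs : IsHomog s p q) :
    IsHomog (r + s) p q := by
  rcases hr with rfl | ⟨a, rfl, ha, hq⟩ | ⟨a, rfl, hp, ha⟩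
  · rwa [zero_add]
  · rcases hs with rfl | ⟨b, rfl, hb, -⟩ | ⟨b, rfl, hb, hb'⟩
    · rw [add_zero]
      exact Or.inr (Or.inl ⟨a, rfl, ha, hq⟩)
    · obtain rfl : a = b := by omega
      rw [ruv_add_self]
      exact Or.inl rfl
    · obtain rfl : a = 0 := by omega
      obtain rfl : b = 0 := by omega
      rw [pow_zero, pow_zero, ruv_add_self]
      exact Or.inl rfl
  · rcases hs with rfl | ⟨b, rfl, hb, hb'⟩ | ⟨b, rfl, -, hb⟩
    · rw [add_zero]
      exact Or.inr (Or.inr ⟨a, rfl, hp, ha⟩)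
    · obtain rfl : a = 0 := by omega
      obtain rfl : b = 0 := by omega
      rw [pow_zero, pow_zero, ruv_add_self]
      exact Or.inl rfl
    · obtain rfl : a = b := by omega
      rw [ruv_add_self]
      exact Or.inl rfl

lemma IsHomog.mul {r s : RUV} {p q p' q' : ℤ} (hr : IsHomog r p q) (hs : IsHomog s p' q') :
    IsHomog (r * s) (p + p') (q + q') := by
  have huv (a b : ℕ) : Uv ^ (a + 1) * Vv ^ (b + 1) = 0 := by
    rw [pow_succ', pow_succ', mul_mul_mul_comm, Uv_mul_Vv, zero_mul]
  rcases hr with rfl | ⟨a, rfl, rfl, rfl⟩ | ⟨a, rfl, rfl, rfl⟩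
  · exact Or.inl (zero_mul _)
  · rcases hs with rfl | ⟨b, rfl, rfl, rfl⟩ | ⟨b, rfl, rfl, rfl⟩
    · exact Or.inl (mul_zero _)
    · exact Or.inr (Or.inl ⟨a + b, (pow_add _ _ _).symm, by push_cast; ring, by ring⟩)
    · rcases a with _ | a
      · exact Or.inr (Or.inr ⟨b, by simp, by simp, by simp⟩)
      · rcases b with _ | b
        · exact Or.inr (Or.inl ⟨a + 1, by simp, by simp, by simp⟩)
        · exact Or.inl (huv a b)
  · rcases hs with rfl | ⟨b, rfl, rfl, rfl⟩ | ⟨b, rfl, rfl, rfl⟩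
    · exact Or.inl (mul_zero _)
    · rcases a with _ | a
      · exact Or.inr (Or.inl ⟨b, by simp, by simp, by simp⟩)
      · rcases b with _ | b
        · exact Or.inr (Or.inr ⟨a + 1, by simp, by simp, by simp⟩)
        · exact Or.inl (by rw [mul_comm, huv])
    · exact Or.inr (Or.inr ⟨a + b, (pow_add _ _ _).symm, by ring, by push_cast; ring⟩)

/-- The coaction recording bidegrees. -/
noncomputable def degreeHom : RUV →+* AddMonoidAlgebra RUV (ℤ × ℤ) :=
  ruvLift (AddMonoidAlgebra.singleZeroRingHom.comp (algebraMap (ZMod 2) RUV))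
    (AddMonoidAlgebra.single (-2, 0) Uv) (AddMonoidAlgebra.single (0, -2) Vv)
    (by rw [AddMonoidAlgebra.single_mul_single, Uv_mul_Vv, AddMonoidAlgebra.single_zero])

lemma degreeHom_of_isHomog {h : RUV} {e : ℤ × ℤ} (hh : IsHomog h e.1 e.2) :
    degreeHom h = AddMonoidAlgebra.single e h := by
  obtain ⟨p, q⟩ := e
  rcases hh with rfl | ⟨a, rfl, ha, hq⟩ | ⟨a, rfl, hp, ha⟩
  · rw [map_zero, AddMonoidAlgebra.single_zero]
  · rw [map_pow, degreeHom, ruvLift_Uv, AddMonoidAlgebra.single_pow]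
    congr 1
    ext
    · rw [Prod.smul_fst, nsmul_eq_mul]; dsimp only at *; omega
    · rw [Prod.smul_snd, nsmul_eq_mul]; dsimp only at *; omega
  · rw [map_pow, degreeHom, ruvLift_Vv, AddMonoidAlgebra.single_pow]
    congr 1
    ext
    · rw [Prod.smul_fst, nsmul_eq_mul]; dsimp only at *; omega
    · rw [Prod.smul_snd, nsmul_eq_mul]; dsimp only at *; omega

/-- The homogeneous component of bidegree `d`. -/
noncomputable def comp (d : ℤ × ℤ) : RUV →+ RUV :=
  ((Finsupp.applyAddHom d).comp AddMonoidAlgebra.coeffAddEquiv.toAddMonoidHom).comp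
    degreeHom.toAddMonoidHom

lemma comp_apply (d : ℤ × ℤ) (r : RUV) : comp d r = (degreeHom r).coeff d := rfl

lemma comp_mul {h : RUV} {e : ℤ × ℤ} (hh : IsHomog h e.1 e.2) (d : ℤ × ℤ) (r : RUV) :
    comp d (h * r) = h * comp (d - e) r := by
  rw [comp_apply, map_mul, degreeHom_of_isHomog hh, AddMonoidAlgebra.coeff_single_mul_apply,
    comp_apply, neg_add_eq_sub]

lemma comp_of_isHomog {h : RUV} {e : ℤ × ℤ} (hh : IsHomog h e.1 e.2) (d : ℤ × ℤ) :
    comp d h = if e = d then h else 0 := by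
  rw [comp_apply, degreeHom_of_isHomog hh, AddMonoidAlgebra.coeff_single, Finsupp.single_apply]

lemma comp_one (d : ℤ × ℤ) : comp d 1 = if (0 : ℤ × ℤ) = d then 1 else 0 :=
  comp_of_isHomog isHomog_one d

lemma comp_Uv_mul (d : ℤ × ℤ) (r : RUV) : comp d (Uv * r) = Uv * comp (d - (-2, 0)) r :=
  comp_mul isHomog_Uv d r

lemma comp_Vv_mul (d : ℤ × ℤ) (r : RUV) : comp d (Vv * r) = Vv * comp (d - (0, -2)) r :=
  comp_mul isHomog_Vv d r

lemma isHomog_comp (d : ℤ × ℤ) (r : RUV) : IsHomog (comp d r) d.1 d.2 := by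
  induction r using ruv_induction generalizing d with
  | h0 => rw [map_zero]; exact isHomog_zero _ _
  | h1 =>
    rw [comp_one]
    split_ifs with h
    · subst h; exact isHomog_one
    · exact isHomog_zero _ _
  | hadd r s hr hs => rw [map_add]; exact (hr d).add (hs d)
  | hU r hr =>
    rw [comp_Uv_mul]
    have := isHomog_Uv.mul (hr (d - (-2, 0)))
    simpa using this
  | hV r hr =>
    rw [comp_Vv_mul]
    have := isHomog_Vv.mul (hr (d - (0, -2)))
    simpa using this

lemma comp_eq_zero_of_pos {d : ℤ × ℤ} (hd : 0 < d.2) (r : RUV) : comp d r = 0 := by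
  rcases isHomog_comp d r with h | ⟨a, -, -, h⟩ | ⟨a, -, -, h⟩
  · exact h
  · omega
  · omega

lemma exists_sum_comp (r : RUV) (g : ℤ × ℤ) :
    ∃ s₀ : Finset (ℤ × ℤ), ∀ s, s₀ ⊆ s → ∑ d ∈ s, comp (d - g) r = r := by
  induction r using ruv_induction generalizing g with
  | h0 => exact ⟨∅, fun s _ => by simp⟩
  | h1 =>
    refine ⟨{g}, fun s hs => ?_⟩
    rw [Finset.sum_eq_single g]
    · rw [sub_self, comp_one, if_pos rfl]
    · intro d _ hd
      rw [comp_one, if_neg]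
      exact fun h => hd (sub_eq_zero.1 h.symm)
    · intro h
      exact absurd (hs (Finset.mem_singleton_self g)) h
  | hadd r s hr hs =>
    obtain ⟨s₁, h₁⟩ := hr g
    obtain ⟨s₂, h₂⟩ := hs g
    refine ⟨s₁ ∪ s₂, fun t ht => ?_⟩
    simp only [map_add]
    rw [Finset.sum_add_distrib, h₁ t (Finset.union_subset_left ht),
      h₂ t (Finset.union_subset_right ht)]
  | hU r hr =>
    obtain ⟨s₁, h₁⟩ := hr (g + (-2, 0))
    refine ⟨s₁, fun t ht => ?_⟩
    simp only [comp_Uv_mul, sub_sub]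
    rw [← Finset.mul_sum, h₁ t ht]
  | hV r hr =>
    obtain ⟨s₁, h₁⟩ := hr (g + (0, -2))
    refine ⟨s₁, fun t ht => ?_⟩
    simp only [comp_Vv_mul, sub_sub]
    rw [← Finset.mul_sum, h₁ t ht]

/-- The differential has bidegree `(-1, -1)`. -/
def IsHomogDiff (C : PreCx) : Prop :=
  ∀ i j, IsHomog (C.dm i j) ((C.gr i).1 - 1 - (C.gr j).1) ((C.gr i).2 - 1 - (C.gr j).2)

section chainComp
variable {C : PreCx}

/-- The homogeneous component of a chain of bidegree `d`. -/
noncomputable def chainComp (C : PreCx) (d : ℤ × ℤ) : Msub C →+ Msub C where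
  toFun c := Finsupp.equivFunOnFinite.symm fun j => comp (d - C.gr j) (c j)
  map_zero' := by ext j; simp
  map_add' x y := by ext j; simp

@[simp] lemma chainComp_apply (d : ℤ × ℤ) (c : Msub C) (j : Fin C.n) :
    chainComp C d c j = comp (d - C.gr j) (c j) := rfl

lemma chainHomog_chainComp (d : ℤ × ℤ) (c : Msub C) : ChainHomog C (chainComp C d c) d.1 d.2 :=
  fun j => isHomog_comp (d - C.gr j) (c j)

lemma chainComp_smul {h : RUV} {e : ℤ × ℤ} (hh : IsHomog h e.1 e.2) (d : ℤ × ℤ) (c : Msub C) :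
    chainComp C d (h • c) = h • chainComp C (d - e) c := by
  ext j
  rw [chainComp_apply, Finsupp.smul_apply, Finsupp.smul_apply, smul_eq_mul, smul_eq_mul,
    comp_mul hh, chainComp_apply, sub_right_comm]

lemma chainComp_smul_of_chainHomog {t : Msub C} {e : ℤ × ℤ} (ht : ChainHomog C t e.1 e.2)
    (d : ℤ × ℤ) (r : RUV) : chainComp C d (r • t) = comp (d - e) r • t := by
  ext j
  rw [chainComp_apply, Finsupp.smul_apply, Finsupp.smul_apply, smul_eq_mul, smul_eq_mul,
    mul_comm, comp_mul (e := e - C.gr j) (ht j), mul_comm, sub_sub_sub_cancel_right]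

lemma exists_sum_chainComp (c : Msub C) :
    ∃ s : Finset (ℤ × ℤ), ∑ d ∈ s, chainComp C d c = c := by
  choose s hs using fun j => exists_sum_comp (c j) (C.gr j)
  refine ⟨Finset.univ.biUnion s, ?_⟩
  ext j
  rw [Finsupp.finsetSum_apply]
  exact hs j _ (Finset.subset_biUnion_of_mem s (Finset.mem_univ j))

lemma chainComp_dmap (hh : IsHomogDiff C) (d : ℤ × ℤ) (c : Msub C) :
    chainComp C d (dmap C c) = dmap C (chainComp C (d + (1, 1)) c) := by
  ext j
  rw [chainComp_apply, dmap_apply, dmap_apply, map_sum]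
  refine Finset.sum_congr rfl fun i _ => ?_
  rw [mul_comm, comp_mul (e := C.gr i - (1, 1) - C.gr j) (hh i j), mul_comm, chainComp_apply]
  congr 2
  abel_nf

/-- Graded submodules. -/
def IsGradedSub (N : Submodule RUV (Msub C)) : Prop := ∀ d, ∀ x ∈ N, chainComp C d x ∈ N

lemma IsGradedSub.sup {N N' : Submodule RUV (Msub C)} (h : IsGradedSub N) (h' : IsGradedSub N') :
    IsGradedSub (N ⊔ N') := by
  intro d x hx
  obtain ⟨y, hy, z, hz, rfl⟩ := Submodule.mem_sup.1 hx
  rw [map_add]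
  exact Submodule.add_mem_sup (h d y hy) (h' d z hz)

lemma isGradedSub_span {t : Msub C} {e : ℤ × ℤ} (ht : ChainHomog C t e.1 e.2) :
    IsGradedSub (Submodule.span RUV {t}) := by
  intro d x hx
  obtain ⟨r, rfl⟩ := Submodule.mem_span_singleton.1 hx
  rw [chainComp_smul_of_chainHomog ht]
  exact Submodule.smul_mem _ _ (Submodule.mem_span_singleton_self t)

lemma isGradedSub_uSub : IsGradedSub (uSub C) := by
  rintro d _ ⟨y, rfl⟩
  rw [LinearMap.lsmul_apply, chainComp_smul (e := (-2, 0)) isHomog_Uv]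
  exact ⟨_, rfl⟩

lemma isGradedSub_range_dmap (hh : IsHomogDiff C) :
    IsGradedSub (LinearMap.range (dmap C)) := by
  rintro d _ ⟨y, rfl⟩
  rw [chainComp_dmap hh]
  exact ⟨_, rfl⟩

/-- Elements `1 + V r` act injectively modulo graded submodules. -/
lemma IsGradedSub.mem_of_one_add_smul_mem {N : Submodule RUV (Msub C)} (hN : IsGradedSub N)
    {r : RUV} {t : Msub C} (h : (1 + Vv * r) • t ∈ N) : t ∈ N := by
  obtain ⟨Q, hQ⟩ : ∃ Q : ℤ, ∀ j, (C.gr j).2 ≤ Q := by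
    obtain ⟨Q, hQ⟩ := (Set.finite_range fun j => (C.gr j).2).bddAbove
    exact ⟨Q, fun j => hQ ⟨j, rfl⟩⟩
  have hsm (q : ℤ) (w : Msub C) (hw : ∀ d : ℤ × ℤ, q < d.2 → chainComp C d w ∈ N) (a : RUV) :
      ∀ d : ℤ × ℤ, q < d.2 → chainComp C d (a • w) ∈ N := by
    induction a using ruv_induction with
    | h0 => intro d _; rw [zero_smul, map_zero]; exact N.zero_mem
    | h1 => rwa [one_smul]
    | hadd a b ha hb =>
      intro d hd
      rw [add_smul, map_add]
      exact N.add_mem (ha d hd) (hb d hd)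
    | hU a ha =>
      intro d hd
      rw [mul_smul, chainComp_smul (e := (-2, 0)) isHomog_Uv]
      exact N.smul_mem _ (ha _ (by simpa using hd))
    | hV a ha =>
      intro d hd
      rw [mul_smul, chainComp_smul (e := (0, -2)) isHomog_Vv]
      exact N.smul_mem _ (ha _ (by simp only [Prod.snd_sub]; omega))
  have key (m : ℕ) : ∀ d : ℤ × ℤ, Q - m < d.2 → chainComp C d t ∈ N := by
    induction m with
    | zero =>
      intro d hd
      have : chainComp C d t = 0 := by
        ext j
        have := hQ j
        rw [chainComp_apply, comp_eq_zero_of_pos, Finsupp.zero_apply]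
        simp only [Prod.snd_sub]
        push_cast at hd
        omega
      rw [this]
      exact N.zero_mem
    | succ m ih =>
      intro d hd
      have h1 := hN d _ h
      rw [add_smul, one_smul, map_add, mul_smul,
        chainComp_smul (e := (0, -2)) isHomog_Vv] at h1
      refine (N.add_mem_iff_left (N.smul_mem _ (hsm (Q - m) t ih r _ ?_))).1 h1
      simp only [Prod.snd_sub]
      push_cast at hd
      omega
  obtain ⟨s, hs⟩ := exists_sum_chainComp t
  rw [← hs]
  refine N.sum_mem fun d _ => key (Q - d.2 + 1).toNat d ?_
  omega

end chainComp

/-- The bidegree `(0, s)` part of a module map. -/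
noncomputable def homogPart {C D : PreCx} (s : ℤ) (f : Msub C →ₗ[RUV] Msub D) :
    Msub C →ₗ[RUV] Msub D :=
  Finsupp.linearCombination RUV fun i => chainComp D (C.gr i + (0, s)) (f (Finsupp.single i 1))

section homogPart
variable {C D : PreCx}

lemma homogPart_single (s : ℤ) (f : Msub C →ₗ[RUV] Msub D) (i : Fin C.n) :
    homogPart s f (Finsupp.single i 1) =
      chainComp D (C.gr i + (0, s)) (f (Finsupp.single i 1)) := by
  rw [homogPart, Finsupp.linearCombination_single, one_smul]

lemma mapHomogShift_homogPart (s : ℤ) (f : Msub C →ₗ[RUV] Msub D) :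
    MapHomogShift C D (homogPart s f) 0 s := by
  intro i j
  rw [homogPart_single]
  exact chainHomog_chainComp _ _ j

/-- The graded part of a map, evaluated on a homogeneous chain. -/
lemma homogPart_apply (s : ℤ) (f : Msub C →ₗ[RUV] Msub D) {x : Msub C} {e : ℤ × ℤ}
    (hx : ChainHomog C x e.1 e.2) :
    homogPart s f x = chainComp D (e + (0, s)) (f x) := by
  rw [map_eq_sum (homogPart s f) x, map_eq_sum f x, map_sum]
  refine Finset.sum_congr rfl fun i _ => ?_
  rw [chainComp_smul (e := e - C.gr i) (hx i), homogPart_single]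
  congr 2
  abel_nf

lemma homogPart_comm {f : Msub C →ₗ[RUV] Msub D} (hf : ∀ x, f (dmap C x) = dmap D (f x))
    (hC : IsHomogDiff C)
    (hD : IsHomogDiff D) (s : ℤ) (x : Msub C) :
    homogPart s f (dmap C x) = dmap D (homogPart s f x) := by
  rw [eq_sum_single x]
  simp only [map_sum, map_smul]
  refine Finset.sum_congr rfl fun i _ => ?_
  congr 1
  have h : ChainHomog C (dmap C (Finsupp.single i 1)) (C.gr i - (1, 1)).1 (C.gr i - (1, 1)).2 := by
    intro j
    rw [dmap_single]
    exact hC i j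
  rw [homogPart_apply s f h, homogPart_single, hf, chainComp_dmap hD]
  congr 2
  abel_nf

end homogPart

/-! ### Towers -/

section towers
variable {C : PreCx}

/-- Chains whose class modulo `U` is a torsion boundary. -/
def satU (C : PreCx) : Submodule RUV (Msub C) where
  carrier := {z | ∃ k : ℕ, Vv ^ k • z ∈ bdryU C}
  zero_mem' := ⟨0, by rw [smul_zero]; exact Submodule.zero_mem _⟩
  add_mem' := by
    rintro x y ⟨k, hx⟩ ⟨l, hy⟩
    refine ⟨k + l, ?_⟩
    rw [smul_add]
    refine Submodule.add_mem _ ?_ ?_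
    · rw [add_comm, pow_add, mul_smul]
      exact Submodule.smul_mem _ _ hx
    · rw [pow_add, mul_smul]
      exact Submodule.smul_mem _ _ hy
  smul_mem' := by
    rintro r x ⟨k, hx⟩
    refine ⟨k, ?_⟩
    rw [smul_comm]
    exact Submodule.smul_mem _ _ hx

lemma mem_satU {z : Msub C} : z ∈ satU C ↔ ∃ k : ℕ, Vv ^ k • z ∈ bdryU C := Iff.rfl

lemma isVTowerGen_iff {x : Msub C} : IsVTowerGen C x ↔ dmap C x ∈ uSub C ∧ x ∉ satU C ∧
    ∀ z : Msub C, dmap C z ∈ uSub C → ∃ r : RUV, z - r • x ∈ satU C := by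
  simp only [IsVTowerGen, mem_satU, not_exists]

lemma bdryU_le_satU : bdryU C ≤ satU C := fun z hz => ⟨0, by rwa [pow_zero, one_smul]⟩

lemma mem_satU_of_pow_smul_mem {m : ℕ} {z : Msub C} (h : Vv ^ m • z ∈ satU C) : z ∈ satU C := by
  obtain ⟨k, hk⟩ := h
  exact ⟨k + m, by rwa [pow_add, mul_smul]⟩

lemma uSub_le_satU : uSub C ≤ satU C := le_sup_left.trans bdryU_le_satU

lemma Uv_smul_mem_uSub (z : Msub C) : Uv • z ∈ uSub C := ⟨z, rfl⟩

lemma smul_mem_satU_of_toPoly_eq_zero {a : RUV} (h : toPoly 1 a = 0) (x : Msub C) :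
    a • x ∈ satU C := by
  obtain ⟨b, rfl⟩ := toPoly_eq_zero.1 h
  rw [mul_smul]
  exact uSub_le_satU (Uv_smul_mem_uSub _)

lemma cst_eq_zero_of_toPoly_eq_zero {a : RUV} (h : toPoly 1 a = 0) : cst a = 0 := by
  obtain ⟨b, rfl⟩ := toPoly_eq_zero.1 h
  rw [map_mul, cst_tv, zero_mul]

lemma isHomog_Vv_pow (k : ℕ) : IsHomog (Vv ^ k) 0 (-(2 * (k : ℤ))) := Or.inr (Or.inr ⟨k, by simp⟩)

lemma isGradedSub_satU (hh : IsHomogDiff C) : IsGradedSub (satU C) := by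
  rintro d x ⟨k, hk⟩
  refine ⟨k, ?_⟩
  have := (isGradedSub_uSub.sup (isGradedSub_range_dmap hh)) (d + (0, -(2 * (k : ℤ)))) _ hk
  rw [chainComp_smul (e := (0, -(2 * (k : ℤ)))) (isHomog_Vv_pow k), add_sub_cancel_right] at this
  exact this

lemma exists_eq_pow_mul_one_add {p : RUV} (hp : toPoly 1 p ≠ 0) :
    ∃ (m : ℕ) (r s : RUV), p = Vv ^ m * (1 + Vv * r) + Uv * s := by
  obtain ⟨g, hg, hX⟩ := Polynomial.exists_eq_pow_rootMultiplicity_mul_and_not_dvd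
    (toPoly 1 p) hp 0
  rw [Polynomial.C_0, sub_zero] at hg hX
  have h0 : g.coeff 0 = 1 := by
    rcases zmod2_cases (g.coeff 0) with h | h
    · exact absurd (Polynomial.X_dvd_iff.2 h) hX
    · exact h
  obtain ⟨s, hs⟩ := tv_dvd_sub_eval 1 p
  refine ⟨(toPoly 1 p).rootMultiplicity 0,
    Polynomial.eval₂ (algebraMap (ZMod 2) RUV) Vv g.divX, s, ?_⟩
  have hg' : g = 1 + Polynomial.X * g.divX := by
    conv_lhs => rw [← Polynomial.X_mul_divX_add g, h0, map_one, add_comm]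
  have he : Polynomial.eval₂ (algebraMap (ZMod 2) RUV) Vv g =
      1 + Vv * Polynomial.eval₂ (algebraMap (ZMod 2) RUV) Vv g.divX := by
    conv_lhs => rw [hg']
    rw [Polynomial.eval₂_add, Polynomial.eval₂_one, Polynomial.eval₂_mul, Polynomial.eval₂_X]
  have hp' : Polynomial.eval₂ (algebraMap (ZMod 2) RUV) (tv 1) (toPoly 1 p) =
      Vv ^ (toPoly 1 p).rootMultiplicity 0 * Polynomial.eval₂ (algebraMap (ZMod 2) RUV) Vv g := by
    conv_lhs => rw [hg]
    rw [tv_one, Polynomial.eval₂_mul, Polynomial.eval₂_pow, Polynomial.eval₂_X]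
  rw [← he, ← hp']
  exact sub_eq_iff_eq_add'.1 hs

lemma toPoly_eq_zero_of_smul_mem (hh : IsHomogDiff C) {p : RUV} {t : Msub C}
    (h : p • t ∈ satU C) (ht : t ∉ satU C) : toPoly 1 p = 0 := by
  by_contra hp
  obtain ⟨m, r, s, rfl⟩ := exists_eq_pow_mul_one_add hp
  rw [add_smul, mul_smul, mul_smul, (satU C).add_mem_iff_left
    (uSub_le_satU (Uv_smul_mem_uSub _))] at h
  exact ht ((isGradedSub_satU hh).mem_of_one_add_smul_mem (mem_satU_of_pow_smul_mem h))

lemma IsVTowerGen.sub_mem (hh : IsHomogDiff C) {x y : Msub C} (hx : IsVTowerGen C x)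
    (hy : IsVTowerGen C y) : x - y ∈ satU C := by
  rw [isVTowerGen_iff] at hx hy
  obtain ⟨r, hr⟩ := hx.2.2 y hy.1
  obtain ⟨s, hs⟩ := hy.2.2 x hx.1
  have h1 : (1 - s * r) • x ∈ satU C := by
    have := (satU C).add_mem hs ((satU C).smul_mem s hr)
    rwa [smul_sub, sub_add_sub_cancel, smul_smul, ← one_smul RUV x, smul_smul, ← sub_smul,
      mul_one] at this
  have h2 := toPoly_eq_zero_of_smul_mem hh h1 hx.2.1
  rw [map_sub, map_one, map_mul, sub_eq_zero] at h2
  obtain ⟨c, hc, hc'⟩ := Polynomial.isUnit_iff.1 (IsUnit.of_mul_eq_one_right _ h2.symm)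
  have hc1 : c = 1 := (zmod2_cases c).resolve_left hc.ne_zero
  have h3 : toPoly 1 (r - 1) = 0 := by rw [map_sub, ← hc', hc1, map_one, map_one, sub_self]
  have h4 := (satU C).add_mem hr (smul_mem_satU_of_toPoly_eq_zero h3 x)
  rw [sub_smul, one_smul, sub_add_sub_cancel] at h4
  rw [← neg_sub]
  exact (satU C).neg_mem h4

lemma IsVTowerGen.congr {x y : Msub C} (hx : IsVTowerGen C x) (hy : dmap C y ∈ uSub C)
    (h : x - y ∈ satU C) : IsVTowerGen C y := by
  rw [isVTowerGen_iff] at hx ⊢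
  refine ⟨hy, fun hs => hx.2.1 (((satU C).sub_mem_iff_left hs).1 h), fun z hz => ?_⟩
  obtain ⟨r, hr⟩ := hx.2.2 z hz
  refine ⟨r, ?_⟩
  have := (satU C).add_mem hr ((satU C).smul_mem r h)
  rwa [smul_sub, sub_add_sub_cancel] at this

lemma dmap_chainComp_mem_uSub (hh : IsHomogDiff C) {x : Msub C} (hx : dmap C x ∈ uSub C)
    (d : ℤ × ℤ) : dmap C (chainComp C d x) ∈ uSub C := by
  have := isGradedSub_uSub (d - (1, 1)) _ hx
  rwa [chainComp_dmap hh, sub_add_cancel] at this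

lemma comp_zero_of_cst_eq_one {r : RUV} (h : cst r = 1) : comp 0 r = 1 := by
  have h0 : cst (r - 1) = 0 := by rw [map_sub, h, map_one, sub_self]
  obtain ⟨a, b, hab⟩ := exists_of_cst_eq_zero 0 h0
  rw [sub_eq_iff_eq_add'.1 hab, tv_zero, zero_add, tv_one, map_add, map_add, comp_one,
    if_pos rfl, comp_Uv_mul, comp_Vv_mul, comp_eq_zero_of_pos (d := 0 - (0, -2)) (by simp),
    mul_zero, add_zero]
  have : comp (0 - (-2, 0)) a = 0 := by
    rcases isHomog_comp (0 - (-2, 0)) a with h | ⟨n, -, h, -⟩ | ⟨n, -, h, -⟩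
    · exact h
    · simp only [Prod.fst_sub, Prod.fst_zero] at h; omega
    · simp only [Prod.fst_sub, Prod.fst_zero] at h; omega
  rw [this, mul_zero, add_zero]

lemma IsVTowerGen.chainComp (hh : IsHomogDiff C) {t c : Msub C} {e : ℤ × ℤ} {r : RUV}
    (ht : IsVTowerGen C t) (hte : ChainHomog C t e.1 e.2) (hc : dmap C c ∈ uSub C)
    (h : c - r • t ∈ satU C) (hr : cst r = 1) : IsVTowerGen C (chainComp C e c) := by
  refine ht.congr (dmap_chainComp_mem_uSub hh hc e) ?_
  have := isGradedSub_satU hh e _ h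
  rw [map_sub, chainComp_smul_of_chainHomog hte, sub_self, comp_zero_of_cst_eq_one hr,
    one_smul] at this
  rw [← neg_sub]
  exact (satU C).neg_mem this

/-- Knot-like complexes have homogeneous tower generators. -/
lemma exists_homog_towerGen (hC : IsKnotLike C) :
    ∃ (τ : Msub C) (d : ℤ), ChainHomog C τ 0 d ∧ IsVTowerGen C τ := by
  have hh : IsHomogDiff C := hC.dhomog
  obtain ⟨t, ht⟩ := hC.vTowerExists
  rw [isVTowerGen_iff] at ht
  obtain ⟨htc, hts, htg⟩ := ht
  obtain ⟨s, hs⟩ := exists_sum_chainComp t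
  choose r hr using fun e => htg _ (dmap_chainComp_mem_uSub hh htc e)
  have h1 : (1 - ∑ e ∈ s, r e) • t ∈ satU C := by
    have := (satU C).sum_mem (fun e (_ : e ∈ s) => hr e)
    rwa [Finset.sum_sub_distrib, hs, ← Finset.sum_smul, ← one_smul RUV t, smul_smul,
      ← sub_smul, mul_one] at this
  have h2 := cst_eq_zero_of_toPoly_eq_zero (toPoly_eq_zero_of_smul_mem hh h1 hts)
  rw [map_sub, map_one, map_sum, sub_eq_zero] at h2
  obtain ⟨e, -, he⟩ := Finset.exists_ne_zero_of_sum_ne_zero (h2 ▸ one_ne_zero)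
  have hte : chainComp C e t ∉ satU C := by
    intro h
    have := toPoly_eq_zero_of_smul_mem hh (((satU C).sub_mem_iff_right h).1 (hr e)) hts
    exact he (cst_eq_zero_of_toPoly_eq_zero this)
  have hhom := chainHomog_chainComp e t
  have hcyc := dmap_chainComp_mem_uSub hh htc e
  have he0 : e.1 = 0 := hC.vTowerGr _ _ _ hhom hcyc fun k hk => hte ⟨k, hk⟩
  refine ⟨chainComp C e t, e.2, he0 ▸ hhom, isVTowerGen_iff.2 ⟨hcyc, hte, fun z hz => ?_⟩⟩
  have hN : IsGradedSub (Submodule.span RUV {chainComp C e t} ⊔ satU C) :=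
    (isGradedSub_span hhom).sup (isGradedSub_satU hh)
  have hre : cst (r e - 1) = 0 := by
    rw [map_sub, map_one, (zmod2_cases (cst (r e))).resolve_left he, sub_self]
  obtain ⟨a, b, hab⟩ := exists_of_cst_eq_zero 1 hre
  have ht' : t ∈ Submodule.span RUV {chainComp C e t} ⊔ satU C := by
    refine hN.mem_of_one_add_smul_mem (r := a) ?_
    have h3 : (1 + Vv * a) • t =
        chainComp C e t - ((chainComp C e t - r e • t) + Uv • b • t) := by
      rw [sub_eq_iff_eq_add'.1 hab]
      simp only [tv_one, show tv (1 + 1) = Uv from rfl, add_smul, mul_smul, one_smul]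
      abel
    rw [h3]
    exact Submodule.sub_mem _
      (Submodule.mem_sup_left (Submodule.mem_span_singleton_self _))
      (Submodule.mem_sup_right ((satU C).add_mem (hr e) (uSub_le_satU (Uv_smul_mem_uSub _))))
  obtain ⟨_, hy, w, hw, hyw⟩ := Submodule.mem_sup.1 ht'
  obtain ⟨c, rfl⟩ := Submodule.mem_span_singleton.1 hy
  obtain ⟨q, hq⟩ := htg z hz
  refine ⟨q * c, ?_⟩
  have := (satU C).add_mem hq ((satU C).smul_mem q hw)
  rwa [eq_sub_iff_add_eq'.2 hyw, smul_sub, sub_add_sub_cancel, smul_smul] at this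

section reduction
variable (hd : ∀ x, dmap C (dmap C x) = 0)

lemma red_mem_bdrInf_of_mem_satU {y : Msub C} (hy : y ∈ satU C) :
    red C y ∈ (arrows C hd 1).bdrInf := by
  obtain ⟨k, hk⟩ := hy
  obtain ⟨a, ha, _, ⟨v, rfl⟩, hav⟩ := Submodule.mem_sup.1 hk
  refine (arrows C hd 1).mem_bdrInf.2 ⟨k, (arrows C hd 1).mem_bdr.2 ⟨red C v, ?_⟩⟩
  refine mem_arrowRel.2 ⟨y, v, rfl, rfl, ?_⟩
  rw [tv_one, ← hav, sub_add_cancel_right]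
  exact Submodule.neg_mem _ ha

lemma cst_eq_one_of_red_notMem {y t : Msub C} {r : RUV} (h : y - r • t ∈ satU C)
    (hy : red C y ∉ (arrows C hd 1).bdrInf) : cst r = 1 := by
  refine (zmod2_cases _).resolve_left fun hr => hy ?_
  have := red_mem_bdrInf_of_mem_satU hd h
  rwa [map_sub, red_smul, hr, zero_smul, sub_zero] at this

lemma IsVTowerGen.red_mem_cycInf {τ : Msub C} (hτ : IsVTowerGen C τ) :
    red C τ ∈ (arrows C hd 1).cycInf := by
  refine (arrows C hd 1).mem_cycInf.2 fun n => (arrows C hd 1).mem_cyc.2 ⟨0, ?_⟩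
  refine mem_arrowRel.2 ⟨0, τ, map_zero _, rfl, ?_⟩
  rw [smul_zero, sub_zero]
  exact hτ.1

lemma IsVTowerGen.red_notMem_bdrInf (hh : IsHomogDiff C) {τ : Msub C} (hτ : IsVTowerGen C τ) :
    red C τ ∉ (arrows C hd 1).bdrInf := by
  intro h
  obtain ⟨n, hn⟩ := (arrows C hd 1).mem_bdrInf.1 h
  obtain ⟨x, hx⟩ := (arrows C hd 1).mem_bdr.1 hn
  obtain ⟨y', x', hy', -, hxy⟩ := mem_arrowRel.1 hx
  rw [isVTowerGen_iff] at hτ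
  have hy : y' ∈ satU C := by
    refine ⟨n, ?_⟩
    have : Vv ^ n • y' = -(dmap C x' - tv 1 ^ n • y') + dmap C x' := by rw [tv_one]; abel
    rw [this]
    exact Submodule.add_mem_sup (Submodule.neg_mem _ hxy) ⟨x', rfl⟩
  have hyc : dmap C y' ∈ uSub C := by
    refine mem_of_tv_pow_smul_mem (k := 1) (n := n) ?_
    have := Submodule.neg_mem _ (dmap_mem_tSub hxy)
    rwa [map_sub, hd, zero_sub, neg_neg, map_smul] at this
  obtain ⟨a, b, hab⟩ := exists_of_red_eq_zero 1 (x := τ - y') (by rw [map_sub, hy', sub_self])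
  have hτe : τ = y' + (tv 1 • a + tv (1 + 1) • b) := by rw [← hab]; abel
  have hac : dmap C a ∈ uSub C := by
    refine mem_of_tv_smul_mem (k := 1) ?_
    have h1 : tv 1 • dmap C a = dmap C τ - dmap C y' - dmap C (tv (1 + 1) • b) := by
      rw [hτe]
      simp only [map_add, map_smul]
      abel
    rw [h1]
    exact Submodule.sub_mem _ (Submodule.sub_mem _ hτ.1 hyc) (dmap_mem_tSub (smul_mem_tSub _ _))
  obtain ⟨r, hr⟩ := hτ.2.2 a hac
  have h1 : (1 - tv 1 * r) • τ ∈ satU C := by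
    have h2 : (1 - tv 1 * r) • τ = y' + tv (1 + 1) • b + tv 1 • (a - r • τ) := by
      rw [sub_smul, one_smul, mul_smul, smul_sub]
      nth_rewrite 1 [hτe]
      abel
    rw [h2]
    exact Submodule.add_mem _ (Submodule.add_mem _ hy (uSub_le_satU (Uv_smul_mem_uSub _)))
      (Submodule.smul_mem _ _ hr)
  have h3 := cst_eq_zero_of_toPoly_eq_zero (toPoly_eq_zero_of_smul_mem hh h1 hτ.2.1)
  rw [map_sub, map_one, map_mul, cst_tv, zero_mul, sub_zero] at h3
  exact one_ne_zero h3

lemma IsVTowerGen.exists_sub_smul_mem {τ : Msub C} (hτ : IsVTowerGen C τ)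
    (z : Fin C.n → ZMod 2) (hz : z ∈ (arrows C hd 1).cycInf) :
    ∃ c : ZMod 2, z - c • red C τ ∈ (arrows C hd 1).bdrInf := by
  obtain ⟨x', rfl, hx'⟩ := exists_cycle_lift 1 z fun n =>
    (arrows C hd 1).mem_cyc.1 ((arrows C hd 1).mem_cycInf.1 hz n)
  obtain ⟨r, hr⟩ := (isVTowerGen_iff.1 hτ).2.2 x' hx'
  refine ⟨cst r, ?_⟩
  have := red_mem_bdrInf_of_mem_satU hd hr
  rwa [map_sub, red_smul] at this

end reduction

/-- Chain maps preserve torsion boundaries. -/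
lemma map_mem_satU {D : PreCx} {f : Msub C →ₗ[RUV] Msub D}
    (hf : ∀ x, f (dmap C x) = dmap D (f x)) {x : Msub C} (hx : x ∈ satU C) : f x ∈ satU D := by
  obtain ⟨k, hk⟩ := hx
  obtain ⟨_, ⟨a, rfl⟩, _, ⟨v, rfl⟩, hav⟩ := Submodule.mem_sup.1 hk
  refine ⟨k, ?_⟩
  rw [← map_smul, ← hav, map_add, LinearMap.lsmul_apply, map_smul, hf]
  exact Submodule.add_mem_sup ⟨_, rfl⟩ ⟨_, rfl⟩

lemma dmap_map_mem_uSub {D : PreCx} {f : Msub C →ₗ[RUV] Msub D}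
    (hf : ∀ x, f (dmap C x) = dmap D (f x)) {x : Msub C} (hx : dmap C x ∈ uSub C) :
    dmap D (f x) ∈ uSub D := by
  obtain ⟨a, ha⟩ := hx
  rw [← hf, ← ha, LinearMap.lsmul_apply, map_smul]
  exact ⟨_, rfl⟩

/-- A chain map whose value on a homogeneous tower generator is, modulo torsion, a unit multiple
of a tower generator yields a local map. -/
lemma localLE_of_chainMap {D : PreCx} (hC : IsHomogDiff C) (hD : IsHomogDiff D)
    {f : Msub C →ₗ[RUV] Msub D} (hf : ∀ x, f (dmap C x) = dmap D (f x))
    {x : Msub C} {y : Msub D} {d e : ℤ} {r : RUV} (hx : IsVTowerGen C x)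
    (hxd : ChainHomog C x 0 d) (hy : IsVTowerGen D y) (hye : ChainHomog D y 0 e)
    (h : f x - r • y ∈ satU D) (hr : cst r = 1) : LocalLE C D := by
  have hg := homogPart_comm hf hC hD (e - d)
  refine ⟨homogPart (e - d) f, hg, ⟨e - d, mapHomogShift_homogPart _ _⟩, fun z hz => ?_⟩
  have hfx : IsVTowerGen D (homogPart (e - d) f x) := by
    rw [homogPart_apply (e - d) f (e := (0, d)) hxd, Prod.mk_add_mk, add_zero,
      add_sub_cancel]
    exact IsVTowerGen.chainComp hD hy hye (dmap_map_mem_uSub hf hx.1) h hr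
  refine hfx.congr (dmap_map_mem_uSub hg hz.1) ?_
  rw [← map_sub]
  exact map_mem_satU hg (hx.sub_mem hC hz)

end towers

/-! ### The tower of a standard complex -/

section singleTower
variable {C : PreCx}

lemma Uv_dvd_iff {r : RUV} : Uv ∣ r ↔ toPoly 1 r = 0 := (toPoly_eq_zero (k := 1)).symm

lemma mem_uSub_iff {x : Msub C} : x ∈ uSub C ↔ ∀ i, toPoly 1 (x i) = 0 :=
  (mem_tSub_iff (k := 0)).trans (forall_congr' fun _ => Uv_dvd_iff)

lemma toPoly_Vv_pow_mul (m : ℕ) (r : RUV) :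
    toPoly 1 (Vv ^ m * r) = Polynomial.X ^ m * toPoly 1 r := by
  rw [map_mul, map_pow]
  exact congrArg (fun P => P ^ m * toPoly 1 r) (toPoly_tv 1)

lemma toPoly_eq_zero_of_mem_satU {j : Fin C.n} (hj : ∀ i, toPoly 1 (C.dm i j) = 0)
    {z : Msub C} (hz : z ∈ satU C) : toPoly 1 (z j) = 0 := by
  obtain ⟨k, hk⟩ := hz
  obtain ⟨a, ha, _, ⟨v, rfl⟩, hav⟩ := Submodule.mem_sup.1 hk
  have h1 : toPoly 1 ((Vv ^ k • z) j) = 0 := by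
    rw [← hav, Finsupp.add_apply, map_add, mem_uSub_iff.1 ha j, dmap_apply, map_sum, zero_add]
    refine Finset.sum_eq_zero fun i _ => ?_
    rw [map_mul, hj, mul_zero]
  rw [Finsupp.smul_apply, smul_eq_mul, toPoly_Vv_pow_mul] at h1
  exact (mul_eq_zero.1 h1).resolve_left (pow_ne_zero _ Polynomial.X_ne_zero)

lemma isVTowerGen_single (i₀ : Fin C.n) (hr : ∀ j, toPoly 1 (C.dm i₀ j) = 0)
    (hc : ∀ i, toPoly 1 (C.dm i i₀) = 0)
    (h : ∀ i, i ≠ i₀ → (Finsupp.single i 1 : Msub C) ∈ satU C ∨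
      ∀ z : Msub C, dmap C z ∈ uSub C → toPoly 1 (z i) = 0) :
    IsVTowerGen C (Finsupp.single i₀ 1) := by
  refine isVTowerGen_iff.2 ⟨mem_uSub_iff.2 fun j => ?_, fun hs => ?_, fun z hz => ⟨z i₀, ?_⟩⟩
  · rw [dmap_single]
    exact hr j
  · have := toPoly_eq_zero_of_mem_satU hc hs
    rw [Finsupp.single_eq_same, map_one] at this
    exact one_ne_zero this
  · have : z - z i₀ • Finsupp.single i₀ 1 =
        ∑ i ∈ Finset.univ.erase i₀, z i • Finsupp.single i (1 : RUV) := by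
      rw [sub_eq_iff_eq_add', Finset.add_sum_erase _ (fun i => z i • Finsupp.single i (1 : RUV))
        (Finset.mem_univ i₀)]
      exact eq_sum_single z
    rw [this]
    refine (satU C).sum_mem fun i hi => ?_
    rcases h i (Finset.ne_of_mem_erase hi) with h | h
    · exact (satU C).smul_mem _ h
    · exact smul_mem_satU_of_toPoly_eq_zero (h z hz) _

lemma single_mem_satU {i j : Fin C.n} {m : ℕ} (h : toPoly 1 (C.dm i j) = Polynomial.X ^ m)
    (h' : ∀ l, l ≠ j → toPoly 1 (C.dm i l) = 0) : (Finsupp.single j 1 : Msub C) ∈ satU C := by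
  refine ⟨m, ?_⟩
  have h1 : Vv ^ m • (Finsupp.single j 1 : Msub C) - dmap C (Finsupp.single i 1) ∈ uSub C := by
    refine mem_uSub_iff.2 fun l => ?_
    rw [Finsupp.sub_apply, Finsupp.smul_apply, smul_eq_mul, dmap_single, map_sub,
      toPoly_Vv_pow_mul]
    rcases eq_or_ne l j with rfl | hl
    · rw [Finsupp.single_eq_same, map_one, mul_one, h, sub_self]
    · rw [Finsupp.single_eq_of_ne hl, map_zero, mul_zero, h' l hl, sub_zero]
  have := Submodule.add_mem_sup h1 (LinearMap.mem_range_self (dmap C) (Finsupp.single i 1))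
  rwa [sub_add_cancel] at this

lemma toPoly_eq_zero_of_dmap_mem {i j : Fin C.n} {m : ℕ}
    (h : toPoly 1 (C.dm i j) = Polynomial.X ^ m)
    (h' : ∀ l, l ≠ i → toPoly 1 (C.dm l j) = 0) (z : Msub C) (hz : dmap C z ∈ uSub C) :
    toPoly 1 (z i) = 0 := by
  have h1 := mem_uSub_iff.1 hz j
  rw [dmap_apply, map_sum, Finset.sum_eq_single i, map_mul, h] at h1
  · exact (mul_eq_zero.1 h1).resolve_right (pow_ne_zero _ Polynomial.X_ne_zero)
  · intro l _ hl
    rw [map_mul, h' l hl, mul_zero]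
  · simp

end singleTower

/-- The standard complex, reducibly. -/
noncomputable abbrev stdModel (L : List ℤ) : PreCx := ⟨L.length + 1, stdGr L, stdDm L⟩

lemma isHomogDiff_stdModel (L : List ℤ) : IsHomogDiff (stdModel L) := by
  intro i j
  dsimp only [stdModel, stdGr, stdDm]
  have hg (k : ℕ) : grRel L (k + 1) = grRel L k + stepShift k (L.getD k 0) :=
    Finset.sum_range_succ _ _
  split_ifs with h1 h2 h2 h3
  · refine Or.inr (Or.inl ⟨_, rfl, ?_, ?_⟩)
    · rw [h1.1, hg, stepShift, if_pos h2, if_pos h1.2, Prod.fst_add]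
      ring
    · rw [h1.1, hg, stepShift, if_pos h2, if_pos h1.2, Prod.snd_add]
      ring
  · refine Or.inr (Or.inr ⟨_, rfl, ?_, ?_⟩)
    · rw [h1.1, hg, stepShift, if_neg h2, if_pos h1.2, Prod.fst_add]
      ring
    · rw [h1.1, hg, stepShift, if_neg h2, if_pos h1.2, Prod.snd_add]
      ring
  · refine Or.inr (Or.inl ⟨_, rfl, ?_, ?_⟩)
    · rw [h2.1, hg, stepShift, if_pos h3, if_neg h2.2.not_gt, Prod.fst_add]
      ring
    · rw [h2.1, hg, stepShift, if_pos h3, if_neg h2.2.not_gt, Prod.snd_add]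
      ring
  · refine Or.inr (Or.inr ⟨_, rfl, ?_, ?_⟩)
    · rw [h2.1, hg, stepShift, if_neg h3, if_neg h2.2.not_gt, Prod.fst_add]
      ring
    · rw [h2.1, hg, stepShift, if_neg h3, if_neg h2.2.not_gt, Prod.snd_add]
      ring
  · exact isHomog_zero _ _

lemma toPoly_stdDm (L : List ℤ) (i j : Fin (L.length + 1)) : toPoly 1 (stdDm L i j) =
    if (j : ℕ) = i + 1 ∧ (i : ℕ) % 2 = 1 ∧ L.getD (i : ℕ) 0 < 0 then
      Polynomial.X ^ (L.getD (i : ℕ) 0).natAbs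
    else if (i : ℕ) = j + 1 ∧ (j : ℕ) % 2 = 1 ∧ 0 < L.getD (j : ℕ) 0 then
      Polynomial.X ^ (L.getD (j : ℕ) 0).natAbs
    else 0 := by
  have hU : toPoly 1 Uv = 0 := toPoly_tv_succ 1
  have hV : toPoly 1 Vv = Polynomial.X := toPoly_tv 1
  unfold stdDm
  by_cases h1 : (j : ℕ) = i + 1 ∧ L.getD (i : ℕ) 0 < 0
  · have h2 : ¬ (i : ℕ) = i + 1 + 1 := by omega
    rcases Nat.mod_two_eq_zero_or_one (i : ℕ) with h | h
    · simp only [h1, h, h2, and_self, if_true, map_pow, hU, zero_ne_one, false_and, and_false,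
        if_false]
      exact zero_pow (by omega)
    · simp only [h1, h, and_self, if_true, one_ne_zero, if_false, map_pow, hV]
  · rw [if_neg h1, if_neg (c := (j : ℕ) = i + 1 ∧ (i : ℕ) % 2 = 1 ∧ _) (fun h => h1 ⟨h.1, h.2.2⟩)]
    by_cases h2 : (i : ℕ) = j + 1 ∧ 0 < L.getD (j : ℕ) 0
    · rcases Nat.mod_two_eq_zero_or_one (j : ℕ) with h | h
      · simp only [h2, h, and_self, if_true, map_pow, hU, zero_ne_one, false_and, and_false,
          if_false]
        exact zero_pow (by omega)
      · simp only [h2, h, and_self, if_true, one_ne_zero, if_false, map_pow, hV]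
    · rw [if_neg h2, if_neg (fun h => h2 ⟨h.1, h.2.2⟩), map_zero]

lemma toPoly_stdDm_zero_right (L : List ℤ) (i : Fin (L.length + 1)) :
    toPoly 1 (stdDm L i 0) = 0 := by
  rw [toPoly_stdDm, if_neg, if_neg] <;> simp

lemma toPoly_stdDm_zero_left (L : List ℤ) (i : Fin (L.length + 1)) :
    toPoly 1 (stdDm L 0 i) = 0 := by
  rw [toPoly_stdDm, if_neg, if_neg] <;> simp

lemma isVTowerGen_stdModel {L : List ℤ} (hL : IsStdSeq L) :
    IsVTowerGen (stdModel L) (Finsupp.single (0 : Fin (L.length + 1)) 1) := by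
  refine isVTowerGen_single (C := stdModel L) _ (toPoly_stdDm_zero_left L)
    (toPoly_stdDm_zero_right L) fun i hi => ?_
  obtain ⟨hb, he⟩ := hL
  have hLk (k : ℕ) (hk : k < L.length) : L.getD k 0 ≠ 0 := by
    rw [List.getD_eq_getElem _ _ hk]
    exact hb _ (List.getElem_mem hk)
  have key (k : ℕ) (hk : k < L.length) (hko : k % 2 = 1) :
      ∃ u v : Fin (L.length + 1), ((u : ℕ) = k ∧ (v : ℕ) = k + 1 ∨ (v : ℕ) = k ∧ (u : ℕ) = k + 1) ∧
      (Finsupp.single v 1 : Msub (stdModel L)) ∈ satU (stdModel L) ∧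
      ∀ z : Msub (stdModel L), dmap (stdModel L) z ∈ uSub (stdModel L) → toPoly 1 (z u) = 0 := by
    rcases lt_or_gt_of_ne (hLk k hk) with hs | hs
    · have h1 : toPoly 1 (stdDm L ⟨k, by omega⟩ ⟨k + 1, by omega⟩) =
          Polynomial.X ^ (L.getD k 0).natAbs := by
        rw [toPoly_stdDm, if_pos ⟨rfl, hko, hs⟩]
      refine ⟨⟨k, by omega⟩, ⟨k + 1, by omega⟩, Or.inl ⟨rfl, rfl⟩,
        single_mem_satU (C := stdModel L) h1 fun l hl => ?_,
        toPoly_eq_zero_of_dmap_mem (C := stdModel L) h1 fun l hl => ?_⟩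
      · have hl' : (l : ℕ) ≠ k + 1 := fun h => hl (Fin.ext h)
        change toPoly 1 (stdDm L _ l) = 0
        rw [toPoly_stdDm, if_neg (fun h => hl' h.1), if_neg]
        rintro ⟨h, h', -⟩
        dsimp only at h
        omega
      · have hl' : (l : ℕ) ≠ k := fun h => hl (Fin.ext h)
        change toPoly 1 (stdDm L l _) = 0
        rw [toPoly_stdDm, if_neg, if_neg]
        · rintro ⟨h, h', -⟩
          dsimp only at h'
          omega
        · rintro ⟨h, h', -⟩
          dsimp only at h
          omega
    · have h1 : toPoly 1 (stdDm L ⟨k + 1, by omega⟩ ⟨k, by omega⟩) =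
          Polynomial.X ^ (L.getD k 0).natAbs := by
        rw [toPoly_stdDm, if_neg, if_pos ⟨rfl, hko, hs⟩]
        rintro ⟨h, h', -⟩
        dsimp only at h
        omega
      refine ⟨⟨k + 1, by omega⟩, ⟨k, by omega⟩, Or.inr ⟨rfl, rfl⟩,
        single_mem_satU (C := stdModel L) h1 fun l hl => ?_,
        toPoly_eq_zero_of_dmap_mem (C := stdModel L) h1 fun l hl => ?_⟩
      · have hl' : (l : ℕ) ≠ k := fun h => hl (Fin.ext h)
        change toPoly 1 (stdDm L _ l) = 0
        rw [toPoly_stdDm, if_neg, if_neg]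
        · rintro ⟨h, h', -⟩
          dsimp only at h
          omega
        · rintro ⟨h, h', -⟩
          dsimp only at h h'
          omega
      · have hl' : (l : ℕ) ≠ k + 1 := fun h => hl (Fin.ext h)
        change toPoly 1 (stdDm L l _) = 0
        rw [toPoly_stdDm, if_neg, if_neg (fun h => hl' h.1)]
        rintro ⟨h, h', -⟩
        dsimp only at h
        omega
  have hi0 : (i : ℕ) ≠ 0 := fun h => hi (Fin.ext h)
  have hi1 : (i : ℕ) < L.length + 1 := i.2
  obtain ⟨m, hm⟩ := he
  obtain ⟨k, hk, hko, hki⟩ : ∃ k, k < L.length ∧ k % 2 = 1 ∧ ((i : ℕ) = k ∨ (i : ℕ) = k + 1) := by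
    rcases Nat.mod_two_eq_zero_or_one (i : ℕ) with h | h
    · exact ⟨i - 1, by omega, by omega, Or.inr (by omega)⟩
    · exact ⟨i, by omega, h, Or.inl rfl⟩
  obtain ⟨u, v, huv, hv, hu⟩ := key k hk hko
  have : i = v ∨ i = u := by
    rcases huv with h | h <;> rcases hki with h' | h'
    · exact Or.inr (Fin.ext (by omega))
    · exact Or.inl (Fin.ext (by omega))
    · exact Or.inl (Fin.ext (by omega))
    · exact Or.inr (Fin.ext (by omega))
  rcases this with rfl | rfl
  · exact Or.inl hv
  · exact Or.inr hu

/-! ### The local equivalence -/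

section final
variable {C : PreCx}

lemma dmap_single_eq_sum (i : Fin C.n) :
    dmap C (Finsupp.single i 1) = ∑ j, C.dm i j • Finsupp.single j (1 : RUV) := by
  rw [eq_sum_single (dmap C (Finsupp.single i 1))]
  exact Finset.sum_congr rfl fun j _ => by rw [dmap_single]

lemma chainHomog_single_stdModel (L : List ℤ) :
    ChainHomog (stdModel L) (Finsupp.single (0 : Fin (L.length + 1)) 1) 0 (stdGr L 0).2 := by
  intro j
  rcases eq_or_ne j (0 : Fin (L.length + 1)) with rfl | hj
  · rw [Finsupp.single_eq_same]
    have h0 : (stdGr L 0).1 = 0 := by simp [stdGr, grRel]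
    change IsHomog 1 (0 - (stdGr L 0).1) ((stdGr L 0).2 - (stdGr L 0).2)
    rw [h0, sub_self, sub_self]
    exact isHomog_one
  · rw [Finsupp.single_eq_of_ne hj]
    exact isHomog_zero _ _

lemma isStdSeq_map_range {n : ℕ} (hn : Even n) {b : ℕ → ℤ} (hb : ∀ i < n, b i ≠ 0) :
    IsStdSeq ((List.range n).map b) := by
  refine ⟨fun x hx => ?_, by simpa using hn⟩
  obtain ⟨i, hi, rfl⟩ := List.mem_map.1 hx
  exact hb i (List.mem_range.1 hi)

lemma exists_chainMap_of_stdSum {n : ℕ} {b : ℕ → ℤ} {c : ℕ → Msub C}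
    (hc : ∀ i ≤ n, dmap C (c i) = stdSum n b c i) :
    ∃ f : Msub (stdModel ((List.range n).map b)) →ₗ[RUV] Msub C,
      (∀ x, f (dmap _ x) = dmap C (f x)) ∧
      f (Finsupp.single (0 : Fin (((List.range n).map b).length + 1)) 1) = c 0 := by
  set L := (List.range n).map b with hL
  have hf (i : Fin (L.length + 1)) :
      Finsupp.linearCombination RUV (fun i : Fin (L.length + 1) => c i) (Finsupp.single i 1) =
        c i := by
    rw [Finsupp.linearCombination_single, one_smul]
  refine ⟨Finsupp.linearCombination RUV fun i : Fin (L.length + 1) => c i, fun x => ?_, hf 0⟩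
  rw [eq_sum_single x]
  simp only [map_sum, map_smul]
  refine Finset.sum_congr rfl fun i _ => congrArg _ ?_
  have hi : (i : ℕ) ≤ n := by
    have := i.2
    simp only [hL, List.length_map, List.length_range] at this
    omega
  rw [dmap_single_eq_sum, hf, hc i hi, ← sum_stdDm_smul, map_sum]
  refine Finset.sum_congr rfl fun j _ => ?_
  rw [map_smul, hf]

lemma exists_chainMap_of_transpose_stdSum {n : ℕ} {b : ℕ → ℤ} {G : ℕ → Msub (transposeCx C)}
    (hG : ∀ i ≤ n, dmap (transposeCx C) (G i) = stdSum n (fun k => -b k) G i) :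
    ∃ g : Msub C →ₗ[RUV] Msub (stdModel ((List.range n).map b)),
      (∀ x, g (dmap C x) = dmap _ (g x)) ∧
      ∀ x, g x (0 : Fin (((List.range n).map b).length + 1)) = ∑ k, x k * G 0 k := by
  set L := (List.range n).map b with hL
  let v (k : Fin C.n) : Msub (stdModel L) :=
    Finsupp.equivFunOnFinite.symm fun i : Fin (L.length + 1) => G i k
  have hv (k : Fin C.n) (i : Fin (L.length + 1)) : v k i = G i k := rfl
  have hg (x : Msub C) (i : Fin (L.length + 1)) :
      Finsupp.linearCombination RUV v x i = ∑ k, x k * G i k := by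
    rw [map_eq_sum (Finsupp.linearCombination RUV v) x, Finsupp.finsetSum_apply]
    refine Finset.sum_congr rfl fun k _ => ?_
    rw [Finsupp.smul_apply, Finsupp.linearCombination_single, one_smul, hv, smul_eq_mul]
  refine ⟨Finsupp.linearCombination RUV v, fun x => ?_, fun x => hg x 0⟩
  ext i
  have hi : (i : ℕ) ≤ n := by
    have : (i : ℕ) < L.length + 1 := i.2
    simp only [hL, List.length_map, List.length_range] at this
    omega
  have h1 (l : Fin C.n) : ∑ k, C.dm l k * G i k =
      ∑ j : Fin (L.length + 1), G j l * stdDm L j i := by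
    have := DFunLike.congr_fun ((hG i hi).trans (sum_stdDm_transpose_smul n b G i).symm) l
    rw [dmap_apply, Finsupp.finsetSum_apply] at this
    refine ((Finset.sum_congr rfl fun k _ => mul_comm _ _).trans this).trans ?_
    exact Finset.sum_congr rfl fun j _ => mul_comm _ _
  have h2 : ∑ k, dmap C x k * G i k = ∑ l, x l * ∑ k, C.dm l k * G i k := by
    simp only [dmap_apply, Finset.mul_sum, Finset.sum_mul, mul_assoc]
    exact Finset.sum_comm
  have h3 : ∑ j : Fin (L.length + 1), (∑ l, x l * G j l) * stdDm L j i =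
      ∑ l, x l * ∑ j : Fin (L.length + 1), G j l * stdDm L j i := by
    simp only [Finset.mul_sum, Finset.sum_mul, mul_assoc]
    exact Finset.sum_comm
  rw [hg, h2, dmap_apply]
  refine (Finset.sum_congr rfl fun l _ => congrArg _ (h1 l)).trans (h3.symm.trans ?_)
  exact Finset.sum_congr rfl fun j _ => congrArg (· * stdDm L j i) (hg x j).symm

lemma cst_sum_mul_eq {f : Module.Dual (ZMod 2) (Fin C.n → ZMod 2)} {G : Msub (transposeCx C)}
    (hG : red (transposeCx C) G = dualVec f) (x : Msub C) :
    cst (∑ k, x k * G k) = f (red C x) := by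
  rw [map_sum, ← Finset.univ_sum_single (red C x), map_sum]
  refine Finset.sum_congr rfl fun k _ => ?_
  have h : cst (G k) = f (Pi.single k 1) := congrFun hG k
  have h' : (Pi.single k (red C x k) : Fin C.n → ZMod 2) = cst (x k) • Pi.single k 1 := by
    rw [← Pi.single_smul, smul_eq_mul, mul_one, red_apply]
  rw [map_mul, h, h', map_smul, smul_eq_mul]

end final

/-- Every knot-like complex over `R = 𝔽₂[U,V]/(UV=0)` is locally
equivalent to a standard complex `C(a_1, …, a_n)` for some (possibly empty) finite
sequence `(a_1, …, a_n)` of nonzero integers with `n` even. -/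
theorem every_knotlike_locally_equivalent_to_standard (C : PreCx) (hC : IsKnotLike C) :
    ∃ L : List ℤ, IsStdSeq L ∧ LocalEquiv C (StdCx L) := by
  have hd := hC.dsq
  have hh : IsHomogDiff C := hC.dhomog
  obtain ⟨τ, d, hτd, hτ⟩ := exists_homog_towerGen hC
  obtain ⟨n, b, x, f, hn, hp, hx0, hf0, hxn, hfn⟩ :=
    ArrowSystem.exists_tower_path (σ := arrows C hd) (arrows_add_two hd) (arrows_cyc_one hd)
      (arrows_bdr_zero hd) (red C τ) (hτ.red_mem_cycInf hd) (hτ.red_notMem_bdrInf hd hh)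
      (hτ.exists_sub_smul_mem hd)
  have hL := isStdSeq_map_range hn hp.ne_zero
  have hx := isVTowerGen_stdModel hL
  have hxd := chainHomog_single_stdModel ((List.range n).map b)
  refine ⟨(List.range n).map b, hL, ?_, ?_⟩
  · obtain ⟨z, hz, hzd⟩ := exists_dualVec_lift hd 1 hf0
    obtain ⟨w, hw, hwd⟩ := exists_dualVec_lift hd 0 hfn
    obtain ⟨G, hG⟩ := exists_path_lift (C := transposeCx C) (transposeCx_dmap_dmap hd) hn
      (b := fun k => -b k) (ξ := fun i => dualVec (f i))
      (fun i hi => neg_ne_zero.2 (hp.ne_zero i hi))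
      (fun i hi => dualVec_mem_step hd i (hp.ne_zero i hi) (hp.coStep i hi)) hz hzd hw hwd
    obtain ⟨g, hg, hg0⟩ := exists_chainMap_of_transpose_stdSum fun i hi => (hG i hi).2
    obtain ⟨r, hr⟩ := (isVTowerGen_iff.1 hx).2.2 (g τ) (dmap_map_mem_uSub hg hτ.1)
    refine localLE_of_chainMap hh (isHomogDiff_stdModel _) hg hτ hτd hx hxd hr ?_
    have h1 := cst_eq_zero_of_toPoly_eq_zero
      (toPoly_eq_zero_of_mem_satU (C := stdModel ((List.range n).map b))
        (j := (0 : Fin (((List.range n).map b).length + 1))) (toPoly_stdDm_zero_right _) hr)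
    rw [Finsupp.sub_apply, Finsupp.smul_apply, Finsupp.single_eq_same, smul_eq_mul, mul_one,
      map_sub, hg0, cst_sum_mul_eq (hG 0 (Nat.zero_le n)).1, sub_eq_zero] at h1
    rw [← h1]
    refine (zmod2_cases _).resolve_left fun h0 => hp.pairing 0 (Nat.zero_le n) ?_
    obtain ⟨c, hc⟩ := hτ.exists_sub_smul_mem hd _ hx0
    have h2 := hf0 _ hc
    rwa [map_sub, map_smul, h0, smul_zero, sub_zero] at h2
  · obtain ⟨z, hz, hzd⟩ := exists_cycle_lift 1 (x 0) fun n =>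
      (arrows C hd 1).mem_cyc.1 ((arrows C hd 1).mem_cycInf.1 hx0 n)
    obtain ⟨w, hw, hwd⟩ := exists_cycle_lift 0 (x n) fun n =>
      (arrows C hd 0).mem_cyc.1 ((arrows C hd 0).mem_cycInf.1 hxn n)
    obtain ⟨c, hc⟩ := exists_path_lift hd hn hp.ne_zero hp.step hz hzd hw hwd
    obtain ⟨g, hg, hg0⟩ := exists_chainMap_of_stdSum fun i hi => (hc i hi).2
    obtain ⟨r, hr⟩ := (isVTowerGen_iff.1 hτ).2.2 _ (dmap_map_mem_uSub hg hx.1)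
    refine localLE_of_chainMap (isHomogDiff_stdModel _) hh hg hx hxd hτ hτd hr ?_
    refine cst_eq_one_of_red_notMem hd hr fun hmem => hp.pairing 0 (Nat.zero_le n) (hf0 _ ?_)
    rwa [hg0, (hc 0 (Nat.zero_le n)).1] at hmem
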